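/- arXiv:1307.8025 — 2 statements merged into one kernel-verified Lean document; each statement's English description precedes it below -/
import Mathlib

section
/- Let n ≥ 2, 1 < p < n, p' = p/(p−1), p* = np/(n−p), ω_{n−1} = 2π^{n/2}/Γ(n/2), and let C₂(n,p) = ω_{n−1}^{−1/n} n^{−1/p} ((p−1)/(n−p))^{1/p'} [B(n/p, n/p' + 1)]^{−1/n}, where B is Euler's Beta function. Then for every smooth compactly supported u : ℝⁿ → ℝ, (∫_{ℝⁿ} |u|^{p*} dx)^{1/p*} ≤ C₂(n,p) (∫_{ℝⁿ} |∇u|^p dx)^{1/p}, and C₂(n,p) is the smallest constant for which this inequality holds for all such u. -/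
open Real MeasureTheory Set

/-- Euler's Beta function `B(x,y) = Γ(x)Γ(y)/Γ(x+y)`. -/
noncomputable def eulerBeta (x y : ℝ) : ℝ :=
  Real.Gamma x * Real.Gamma y / Real.Gamma (x + y)

/-- The Aubin–Talenti sharp Sobolev constant
`C₂(n,p) = ω_{n-1}^{-1/n} n^{-1/p} ((p-1)/(n-p))^{1/p'} [B(n/p, n/p'+1)]^{-1/n}`,
where `ω_{n-1} = 2π^{n/2}/Γ(n/2)` and `p' = p/(p-1)`. -/
noncomputable def sobolevC (n : ℕ) (p : ℝ) : ℝ :=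
  (2 * π ^ ((n : ℝ) / 2) / Real.Gamma ((n : ℝ) / 2)) ^ (-(1 / (n : ℝ))) *
    (n : ℝ) ^ (-(1 / p)) *
    (((p - 1) / ((n : ℝ) - p)) ^ (1 / (p / (p - 1)))) *
    (eulerBeta ((n : ℝ) / p) ((n : ℝ) / (p / (p - 1)) + 1)) ^ (-(1 / (n : ℝ)))

/-- The distribution function on `[a, b]` of the probability density proportional to `f`. -/
noncomputable def normalizedPrimitive (a b : ℝ) (f : ℝ → ℝ) (t : ℝ) : ℝ :=
  (∫ s in a..t, f s) / ∫ s in a..b, f s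

/-- The monotone map of the line transporting the normalized density `f` on `[a, b]` to the
normalized density `g` on `[a, b]`. -/
noncomputable def monotoneTransport (a b : ℝ) (f g : ℝ → ℝ) (t : ℝ) : ℝ :=
  Function.invFun (normalizedPrimitive a b g) (normalizedPrimitive a b f t)

section OneDimensional

variable {a b m : ℝ} {f g : ℝ → ℝ}

lemma intervalIntegral_pos_of_le (hab : a < b) (hm : 0 < m) (hf : Continuous f)
    (hmf : ∀ t, m ≤ f t) : 0 < ∫ s in a..b, f s :=
  intervalIntegral.intervalIntegral_pos_of_pos (hf.intervalIntegrable a b)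
    (fun t => hm.trans_le (hmf t)) hab

lemma hasDerivAt_normalizedPrimitive (hf : Continuous f) (t : ℝ) :
    HasDerivAt (normalizedPrimitive a b f) (f t / ∫ s in a..b, f s) t :=
  (hf.integral_hasStrictDerivAt a t).hasDerivAt.div_const _

lemma strictMono_normalizedPrimitive (hab : a < b) (hm : 0 < m) (hf : Continuous f)
    (hmf : ∀ t, m ≤ f t) : StrictMono (normalizedPrimitive a b f) := by
  refine strictMono_of_deriv_pos fun t => ?_
  rw [(hasDerivAt_normalizedPrimitive hf t).deriv]
  exact div_pos (hm.trans_le (hmf t)) (intervalIntegral_pos_of_le hab hm hf hmf)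

lemma surjective_normalizedPrimitive (hab : a < b) (hm : 0 < m) (hf : Continuous f)
    (hmf : ∀ t, m ≤ f t) : Function.Surjective (normalizedPrimitive a b f) := by
  have hI := intervalIntegral_pos_of_le hab hm hf hmf
  have hc : Continuous (normalizedPrimitive a b f) :=
    continuous_iff_continuousAt.2 fun t => (hasDerivAt_normalizedPrimitive hf t).continuousAt
  have hup : ∀ s t, s ≤ t → m * (t - s) ≤ (∫ x in a..t, f x) - ∫ x in a..s, f x := by
    intro s t hst
    rw [intervalIntegral.integral_interval_sub_left (hf.intervalIntegrable _ _)
      (hf.intervalIntegrable _ _)]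
    have h := intervalIntegral.integral_mono_on (μ := volume) hst
      (continuous_const.intervalIntegrable s t) (hf.intervalIntegrable s t) (fun x _ => hmf x)
    simpa [mul_comm] using h
  refine hc.surjective ?_ ?_
  · unfold normalizedPrimitive
    refine Filter.Tendsto.atTop_div_const hI ?_
    refine Filter.tendsto_atTop_mono' _ ?_ ((Filter.tendsto_id.atTop_add
      (tendsto_const_nhds (x := -a))).const_mul_atTop hm)
    filter_upwards [Filter.eventually_ge_atTop a] with t ht
    have := hup a t ht
    simp only [intervalIntegral.integral_same, sub_zero] at this
    simpa [sub_eq_add_neg] using this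
  · unfold normalizedPrimitive
    refine Filter.Tendsto.atBot_div_const hI ?_
    refine Filter.tendsto_atBot_mono' _ ?_ ((Filter.tendsto_id.atBot_add
      (tendsto_const_nhds (x := -a))).const_mul_atBot hm)
    filter_upwards [Filter.eventually_le_atBot a] with t ht
    have := hup t a ht
    simp only [intervalIntegral.integral_same] at this
    simp only [id]
    linarith

lemma normalizedPrimitive_left : normalizedPrimitive a b f a = 0 := by
  simp [normalizedPrimitive]

lemma normalizedPrimitive_right (hab : a < b) (hm : 0 < m) (hf : Continuous f)
    (hmf : ∀ t, m ≤ f t) : normalizedPrimitive a b f b = 1 :=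
  div_self (intervalIntegral_pos_of_le hab hm hf hmf).ne'

lemma normalizedPrimitive_monotoneTransport (hab : a < b) (hm : 0 < m) (hg : Continuous g)
    (hmg : ∀ t, m ≤ g t) (t : ℝ) :
    normalizedPrimitive a b g (monotoneTransport a b f g t) = normalizedPrimitive a b f t :=
  Function.rightInverse_invFun (surjective_normalizedPrimitive hab hm hg hmg) _

lemma monotoneTransport_le_iff (hab : a < b) (hm : 0 < m) (hg : Continuous g) (hmg : ∀ t, m ≤ g t)
    (t s : ℝ) :
    monotoneTransport a b f g t ≤ s ↔
      normalizedPrimitive a b f t ≤ normalizedPrimitive a b g s := by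
  rw [← (strictMono_normalizedPrimitive hab hm hg hmg).le_iff_le,
    normalizedPrimitive_monotoneTransport hab hm hg hmg]

lemma monotoneTransport_left (hab : a < b) (hm : 0 < m) (hg : Continuous g) (hmg : ∀ t, m ≤ g t) :
    monotoneTransport a b f g a = a := by
  apply (strictMono_normalizedPrimitive hab hm hg hmg).injective
  rw [normalizedPrimitive_monotoneTransport hab hm hg hmg, normalizedPrimitive_left,
    normalizedPrimitive_left]

lemma monotoneTransport_right (hab : a < b) (hm : 0 < m) (hf : Continuous f) (hmf : ∀ t, m ≤ f t)
    (hg : Continuous g) (hmg : ∀ t, m ≤ g t) : monotoneTransport a b f g b = b := by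
  apply (strictMono_normalizedPrimitive hab hm hg hmg).injective
  rw [normalizedPrimitive_monotoneTransport hab hm hg hmg,
    normalizedPrimitive_right hab hm hg hmg, normalizedPrimitive_right hab hm hf hmf]

lemma strictMono_monotoneTransport (hab : a < b) (hm : 0 < m) (hf : Continuous f)
    (hmf : ∀ t, m ≤ f t) (hg : Continuous g) (hmg : ∀ t, m ≤ g t) :
    StrictMono (monotoneTransport a b f g) := by
  intro s t hst
  rw [← (strictMono_normalizedPrimitive hab hm hg hmg).lt_iff_lt,
    normalizedPrimitive_monotoneTransport hab hm hg hmg,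
    normalizedPrimitive_monotoneTransport hab hm hg hmg]
  exact strictMono_normalizedPrimitive hab hm hf hmf hst

lemma surjective_monotoneTransport (hab : a < b) (hm : 0 < m) (hf : Continuous f)
    (hmf : ∀ t, m ≤ f t) (hg : Continuous g) (hmg : ∀ t, m ≤ g t) :
    Function.Surjective (monotoneTransport a b f g) := by
  intro s
  obtain ⟨t, ht⟩ := surjective_normalizedPrimitive hab hm hf hmf (normalizedPrimitive a b g s)
  refine ⟨t, (strictMono_normalizedPrimitive hab hm hg hmg).injective ?_⟩
  rw [normalizedPrimitive_monotoneTransport hab hm hg hmg, ht]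

lemma hasDerivAt_monotoneTransport (hab : a < b) (hm : 0 < m) (hf : Continuous f)
    (hmf : ∀ t, m ≤ f t) (hg : Continuous g) (hmg : ∀ t, m ≤ g t) (t : ℝ) :
    HasDerivAt (monotoneTransport a b f g)
      (f t / (∫ s in a..b, f s) * ((∫ s in a..b, g s) / g (monotoneTransport a b f g t))) t := by
  have hτ : Continuous (monotoneTransport a b f g) :=
    (strictMono_monotoneTransport hab hm hf hmf hg hmg).monotone.continuous_of_surjective
      (surjective_monotoneTransport hab hm hf hmf hg hmg)
  have hI := intervalIntegral_pos_of_le hab hm hf hmf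
  have hJ := intervalIntegral_pos_of_le hab hm hg hmg
  have hgpos := hm.trans_le (hmg (monotoneTransport a b f g t))
  set P := normalizedPrimitive a b f
  set iso := (strictMono_normalizedPrimitive hab hm hg hmg).orderIsoOfSurjective _
    (surjective_normalizedPrimitive hab hm hg hmg) with hiso
  have hinv : ∀ y, normalizedPrimitive a b g (iso.symm y) = y := fun y => iso.apply_symm_apply y
  have heq : monotoneTransport a b f g = iso.symm ∘ P := by
    funext s
    apply (strictMono_normalizedPrimitive hab hm hg hmg).injective
    rw [normalizedPrimitive_monotoneTransport hab hm hg hmg, Function.comp_apply, hinv]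
  have h1 : HasDerivAt iso.symm (g (iso.symm (P t)) / ∫ s in a..b, g s)⁻¹ (P t) :=
    HasDerivAt.of_local_left_inverse iso.symm.continuous.continuousAt
      (hasDerivAt_normalizedPrimitive hg _)
      (div_pos (hm.trans_le (hmg _)) hJ).ne' (Filter.Eventually.of_forall hinv)
  have h2 := h1.comp t (hasDerivAt_normalizedPrimitive (a := a) (b := b) hf t)
  rw [← heq] at h2
  rwa [inv_div, mul_comm, ← Function.comp_apply (f := iso.symm), ← heq] at h2

lemma lintegral_comp_monotoneTransport (hab : a < b) (hm : 0 < m) (hf : Continuous f)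
    (hmf : ∀ t, m ≤ f t) (hg : Continuous g) (hmg : ∀ t, m ≤ g t) (φ : ℝ → ENNReal) :
    ∫⁻ t in Ioc a b, φ (monotoneTransport a b f g t) * ENNReal.ofReal (f t) =
      ENNReal.ofReal ((∫ s in a..b, f s) / ∫ s in a..b, g s) *
        ∫⁻ s in Ioc a b, φ s * ENNReal.ofReal (g s) := by
  have hmono := strictMono_monotoneTransport hab hm hf hmf hg hmg
  have hI := intervalIntegral_pos_of_le hab hm hf hmf
  have hJ := intervalIntegral_pos_of_le hab hm hg hmg
  have himg : monotoneTransport a b f g '' Ioc a b = Ioc a b := by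
    ext s
    constructor
    · rintro ⟨t, ht, rfl⟩
      constructor
      · conv_lhs => rw [← monotoneTransport_left (f := f) hab hm hg hmg]
        exact hmono ht.1
      · conv_rhs => rw [← monotoneTransport_right hab hm hf hmf hg hmg]
        exact hmono.monotone ht.2
    · intro hs
      obtain ⟨t, rfl⟩ := surjective_monotoneTransport hab hm hf hmf hg hmg s
      refine ⟨t, ⟨?_, ?_⟩, rfl⟩
      · rw [← hmono.lt_iff_lt, monotoneTransport_left hab hm hg hmg]; exact hs.1
      · rw [← hmono.le_iff_le, monotoneTransport_right hab hm hf hmf hg hmg]; exact hs.2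
  rw [← lintegral_const_mul' _ _ ENNReal.ofReal_ne_top]
  conv_rhs => rw [← himg]
  rw [lintegral_image_eq_lintegral_abs_deriv_mul measurableSet_Ioc
    (fun t _ => (hasDerivAt_monotoneTransport hab hm hf hmf hg hmg t).hasDerivWithinAt)
    hmono.injective.injOn]
  refine lintegral_congr fun t => ?_
  have hft := hm.trans_le (hmf t)
  have hgt := hm.trans_le (hmg (monotoneTransport a b f g t))
  have hmul : f t = f t / (∫ s in a..b, f s) * ((∫ s in a..b, g s) /
      g (monotoneTransport a b f g t)) * ((∫ s in a..b, f s) / (∫ s in a..b, g s)) *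
      g (monotoneTransport a b f g t) := by
    field_simp
  rw [abs_of_pos (by positivity)]
  conv_lhs => rw [hmul]
  rw [ENNReal.ofReal_mul (by positivity), ENNReal.ofReal_mul (by positivity)]
  ring

end OneDimensional

/-- Lebesgue measure restricted to the cube `(a, b]ⁿ`. -/
noncomputable abbrev cubeMeasure (n : ℕ) (a b : ℝ) : Measure (Fin n → ℝ) :=
  Measure.pi fun _ => volume.restrict (Ioc a b)

lemma lintegral_cubeMeasure_succ {n : ℕ} {a b : ℝ} (i : Fin (n + 1))
    {h : (Fin (n + 1) → ℝ) → ENNReal} (hh : Measurable h) :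
    ∫⁻ x, h x ∂cubeMeasure (n + 1) a b =
      ∫⁻ y, (∫⁻ t in Ioc a b, h (i.insertNth t y)) ∂cubeMeasure n a b := by
  have mp := (measurePreserving_piFinSuccAbove (fun _ : Fin (n + 1) => volume.restrict (Ioc a b))
    i).symm
  rw [cubeMeasure, ← mp.lintegral_comp hh, lintegral_prod_symm]
  · rfl
  · exact (hh.comp (MeasurableEquiv.measurable _)).aemeasurable

lemma integral_cubeMeasure_succ {n : ℕ} {a b : ℝ} (i : Fin (n + 1))
    {h : (Fin (n + 1) → ℝ) → ℝ} (hh : Integrable h (cubeMeasure (n + 1) a b)) :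
    ∫ x, h x ∂cubeMeasure (n + 1) a b =
      ∫ y, (∫ t in Ioc a b, h (i.insertNth t y)) ∂cubeMeasure n a b := by
  have mp := (measurePreserving_piFinSuccAbove (fun _ : Fin (n + 1) => volume.restrict (Ioc a b))
    i).symm
  rw [cubeMeasure, ← mp.integral_comp', integral_prod_symm]
  · rfl
  · exact (mp.integrable_comp_emb (MeasurableEquiv.measurableEmbedding _)).2 hh

/-- A triangular map of the cube transporting the density `F` to the density `G`, together with
the diagonal of its Jacobian matrix. -/
structure KnotheMap (n : ℕ) (a b : ℝ) (F G : (Fin n → ℝ) → ℝ) where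
  /-- the underlying map -/
  toFun : (Fin n → ℝ) → (Fin n → ℝ)
  /-- the diagonal of the Jacobian matrix -/
  diag : Fin n → (Fin n → ℝ) → ℝ
  measurable_toFun : Measurable toFun
  measurable_diag : ∀ i, Measurable (diag i)
  diag_nonneg : ∀ i x, 0 ≤ diag i x
  diag_bdd : ∃ K, ∀ i x, diag i x ≤ K
  hasDerivAt : ∀ x i,
    HasDerivAt (fun t => toFun (Function.update x i t) i) (diag i x) (x i)
  prod_diag : ∀ x, (∏ i, diag i x) * G (toFun x) = F x
  left : ∀ x i, toFun (Function.update x i a) i = a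
  right : ∀ x i, toFun (Function.update x i b) i = b
  lintegral_comp : ∀ φ : (Fin n → ℝ) → ENNReal, Measurable φ →
    ∫⁻ x, φ (toFun x) * ENNReal.ofReal (F x) ∂cubeMeasure n a b =
      ∫⁻ x, φ x * ENNReal.ofReal (G x) ∂cubeMeasure n a b

section Marginal

/-- The marginal of a density on the cube obtained by integrating out the first coordinate. -/
noncomputable def headMarginal {n : ℕ} (a b : ℝ) (F : (Fin (n + 1) → ℝ) → ℝ) (y : Fin n → ℝ) : ℝ :=
  ∫ t in a..b, F (Fin.cons t y)

variable {n : ℕ} {a b m M : ℝ} {F G : (Fin (n + 1) → ℝ) → ℝ}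

lemma continuous_finCons {X : Type*} [TopologicalSpace X] {f : X → ℝ} {g : X → Fin n → ℝ}
    (hf : Continuous f) (hg : Continuous g) :
    Continuous fun z => (Fin.cons (f z) (g z) : Fin (n + 1) → ℝ) :=
  Continuous.finCons (A := fun _ => ℝ) hf hg

lemma continuous_comp_cons (hF : Continuous F) (y : Fin n → ℝ) :
    Continuous fun t : ℝ => F (Fin.cons t y) :=
  hF.comp (continuous_finCons continuous_id continuous_const)

lemma continuous_headMarginal (hF : Continuous F) : Continuous (headMarginal a b F) :=
  intervalIntegral.continuous_parametric_intervalIntegral_of_continuous'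
    (f := fun (y : Fin n → ℝ) (t : ℝ) => F (Fin.cons t y))
    (hF.comp (continuous_finCons continuous_snd continuous_fst)) a b

lemma le_headMarginal (hab : a ≤ b) (hF : Continuous F) (hmF : ∀ x, m ≤ F x) (y : Fin n → ℝ) :
    m * (b - a) ≤ headMarginal a b F y := by
  have h := intervalIntegral.integral_mono_on (μ := volume) hab
    (continuous_const.intervalIntegrable a b)
    ((continuous_comp_cons hF y).intervalIntegrable a b) (fun t _ => hmF (Fin.cons t y))
  simpa [headMarginal, mul_comm] using h

lemma headMarginal_le (hab : a ≤ b) (hF : Continuous F) (hFM : ∀ x, F x ≤ M) (y : Fin n → ℝ) :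
    headMarginal a b F y ≤ M * (b - a) := by
  have h := intervalIntegral.integral_mono_on (μ := volume) hab
    ((continuous_comp_cons hF y).intervalIntegrable a b)
    (continuous_const.intervalIntegrable a b) (fun t _ => hFM (Fin.cons t y))
  simpa [headMarginal, mul_comm] using h

lemma integrable_cubeMeasure_of_bound {n : ℕ} {a b M : ℝ} {h : (Fin n → ℝ) → ℝ}
    (hh : Measurable h) (hM : ∀ x, |h x| ≤ M) : Integrable h (cubeMeasure n a b) :=
  Integrable.of_bound hh.aestronglyMeasurable M (Filter.Eventually.of_forall hM)

lemma integral_headMarginal (hab : a ≤ b) (hF : Continuous F) (hmF : ∀ x, m ≤ F x)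
    (hFM : ∀ x, F x ≤ M) :
    ∫ y, headMarginal a b F y ∂cubeMeasure n a b = ∫ x, F x ∂cubeMeasure (n + 1) a b := by
  rw [integral_cubeMeasure_succ 0 (integrable_cubeMeasure_of_bound (M := max |m| |M|)
    hF.measurable fun x => abs_le_max_abs_abs (hmF x) (hFM x))]
  simp_rw [headMarginal, intervalIntegral.integral_of_le hab, Fin.insertNth_zero']

end Marginal

/-- The first coordinate of the triangular transport, given the transport `S` of the others. -/
noncomputable def knotheHead {n : ℕ} (a b : ℝ) (F G : (Fin (n + 1) → ℝ) → ℝ)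
    (S : (Fin n → ℝ) → (Fin n → ℝ)) (x : Fin (n + 1) → ℝ) : ℝ :=
  monotoneTransport a b (fun t => F (Fin.cons t (Fin.tail x)))
    (fun t => G (Fin.cons t (S (Fin.tail x)))) (x 0)

lemma measurable_tail {n : ℕ} : Measurable (Fin.tail : (Fin (n + 1) → ℝ) → Fin n → ℝ) :=
  measurable_pi_iff.2 fun i => measurable_pi_apply i.succ

lemma measurable_finCons {α : Type*} [MeasurableSpace α] {n : ℕ} {f : α → ℝ}
    {g : α → Fin n → ℝ} (hf : Measurable f) (hg : Measurable g) :
    Measurable fun z => (Fin.cons (f z) (g z) : Fin (n + 1) → ℝ) := by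
  refine measurable_pi_iff.2 (Fin.cases ?_ fun i => ?_)
  · simpa using hf
  · simpa [Function.comp_def] using (measurable_pi_apply i).comp hg

lemma continuous_normalizedPrimitive_cons {n : ℕ} {a b m : ℝ} {F : (Fin (n + 1) → ℝ) → ℝ}
    (hab : a < b) (hm : 0 < m) (hF : Continuous F) (hmF : ∀ x, m ≤ F x) :
    Continuous fun p : (Fin n → ℝ) × ℝ =>
      normalizedPrimitive a b (fun t => F (Fin.cons t p.1)) p.2 := by
  unfold normalizedPrimitive
  refine Continuous.div ?_ ((continuous_headMarginal (a := a) (b := b) hF).comp continuous_fst) ?_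
  · exact intervalIntegral.continuous_parametric_intervalIntegral_of_continuous
      (f := fun (p : (Fin n → ℝ) × ℝ) t => F (Fin.cons t p.1))
      (hF.comp (continuous_finCons continuous_snd (continuous_fst.comp continuous_fst)))
      continuous_snd
  · intro p
    exact (intervalIntegral_pos_of_le hab hm (continuous_comp_cons hF p.1)
      (fun t => hmF _)).ne'

lemma measurable_knotheHead {n : ℕ} {a b m : ℝ} {F G : (Fin (n + 1) → ℝ) → ℝ} (hab : a < b)
    (hm : 0 < m) (hF : Continuous F) (hmF : ∀ x, m ≤ F x) (hG : Continuous G)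
    (hmG : ∀ x, m ≤ G x) {S : (Fin n → ℝ) → (Fin n → ℝ)} (hS : Measurable S) :
    Measurable (knotheHead a b F G S) := by
  refine measurable_of_Iic fun s => ?_
  simp only [preimage, mem_Iic, knotheHead,
    fun x : Fin (n + 1) → ℝ => monotoneTransport_le_iff (f := fun t => F (Fin.cons t (Fin.tail x)))
    hab hm (continuous_comp_cons hG (S (Fin.tail x))) (fun t => hmG _) (x 0) s]
  refine measurableSet_le ?_ ?_
  · exact (continuous_normalizedPrimitive_cons hab hm hF hmF).measurable.comp
      (measurable_tail.prodMk (measurable_pi_apply 0))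
  · exact (continuous_normalizedPrimitive_cons hab hm hG hmG).measurable.comp
      ((hS.comp measurable_tail).prodMk measurable_const)

section Step

variable {n : ℕ} {a b m M : ℝ} {F G : (Fin (n + 1) → ℝ) → ℝ}

lemma lintegral_knothe_step (hab : a < b) (hm : 0 < m) (hF : Continuous F) (hmF : ∀ x, m ≤ F x)
    (hG : Continuous G) (hmG : ∀ x, m ≤ G x) {S : (Fin n → ℝ) → (Fin n → ℝ)} (hS : Measurable S)
    (hSF : ∀ φ : (Fin n → ℝ) → ENNReal, Measurable φ →
      ∫⁻ x, φ (S x) * ENNReal.ofReal (headMarginal a b F x) ∂cubeMeasure n a b =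
        ∫⁻ x, φ x * ENNReal.ofReal (headMarginal a b G x) ∂cubeMeasure n a b)
    {φ : (Fin (n + 1) → ℝ) → ENNReal} (hφ : Measurable φ) :
    ∫⁻ x, φ (Fin.cons (knotheHead a b F G S x) (S (Fin.tail x))) * ENNReal.ofReal (F x)
        ∂cubeMeasure (n + 1) a b =
      ∫⁻ x, φ x * ENNReal.ofReal (G x) ∂cubeMeasure (n + 1) a b := by
  have hba : 0 < b - a := sub_pos.2 hab
  have hpos : ∀ {H : (Fin (n + 1) → ℝ) → ℝ}, Continuous H → (∀ x, m ≤ H x) → ∀ y,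
      0 < headMarginal a b H y := fun hH hmH y =>
    (mul_pos hm hba).trans_le (le_headMarginal hab.le hH hmH y)
  have hmeasφ : Measurable fun x : Fin (n + 1) → ℝ =>
      φ (Fin.cons (knotheHead a b F G S x) (S (Fin.tail x))) :=
    hφ.comp (measurable_finCons (measurable_knotheHead hab hm hF hmF hG hmG hS)
      (hS.comp measurable_tail))
  have hmF' : Measurable fun x : Fin (n + 1) → ℝ =>
      φ (Fin.cons (knotheHead a b F G S x) (S (Fin.tail x))) * ENNReal.ofReal (F x) :=
    hmeasφ.mul hF.measurable.ennreal_ofReal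
  have hmG' : Measurable fun x : Fin (n + 1) → ℝ => φ x * ENNReal.ofReal (G x) :=
    hφ.mul hG.measurable.ennreal_ofReal
  rw [lintegral_cubeMeasure_succ 0 hmF', lintegral_cubeMeasure_succ 0 hmG']
  simp only [Fin.insertNth_zero', knotheHead, Fin.tail_cons, Fin.cons_zero]
  set Ψ : (Fin n → ℝ) → ENNReal := fun y =>
    ∫⁻ t in Ioc a b, φ (Fin.cons t y) * ENNReal.ofReal (G (Fin.cons t y)) with hΨ
  have hΨm : Measurable Ψ :=
    Measurable.lintegral_prod_right' (f := fun p : (Fin n → ℝ) × ℝ =>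
      φ (Fin.cons p.2 p.1) * ENNReal.ofReal (G (Fin.cons p.2 p.1)))
      ((hφ.mul hG.measurable.ennreal_ofReal).comp
        (measurable_finCons measurable_snd measurable_fst))
  have hinv : Measurable fun y => ENNReal.ofReal (headMarginal a b G y)⁻¹ :=
    (continuous_headMarginal hG).measurable.inv.ennreal_ofReal
  have h := hSF _ (hΨm.mul hinv)
  calc _ = ∫⁻ y, Ψ (S y) * ENNReal.ofReal (headMarginal a b G (S y))⁻¹ *
        ENNReal.ofReal (headMarginal a b F y) ∂cubeMeasure n a b := by
        refine lintegral_congr fun y => ?_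
        have h1 := lintegral_comp_monotoneTransport hab hm (continuous_comp_cons hF y)
          (fun t => hmF _) (continuous_comp_cons hG (S y)) (fun t => hmG _)
          (fun t => φ (Fin.cons t (S y)))
        rw [h1, hΨ, mul_assoc, ← ENNReal.ofReal_mul (inv_nonneg.2 (hpos hG hmG _).le), mul_comm]
        congr 2
        rw [div_eq_inv_mul]
        rfl
    _ = _ := h
    _ = _ := by
        refine lintegral_congr fun y => ?_
        simp only [Pi.mul_apply]
        rw [mul_assoc, ← ENNReal.ofReal_mul (inv_nonneg.2 (hpos hG hmG _).le),
          inv_mul_cancel₀ (hpos hG hmG y).ne', ENNReal.ofReal_one, mul_one]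

/-- Adding one coordinate to a triangular transport map. -/
noncomputable def KnotheMap.cons
    (hab : a < b) (hm : 0 < m) (hF : Continuous F) (hmF : ∀ x, m ≤ F x) (hFM : ∀ x, F x ≤ M)
    (hG : Continuous G) (hmG : ∀ x, m ≤ G x) (hGM : ∀ x, G x ≤ M)
    (S : KnotheMap n a b (headMarginal a b F) (headMarginal a b G)) :
    KnotheMap (n + 1) a b F G where
  toFun x := Fin.cons (knotheHead a b F G S.toFun x) (S.toFun (Fin.tail x))
  diag i x := (Fin.cons (F x / headMarginal a b F (Fin.tail x) *
    (headMarginal a b G (S.toFun (Fin.tail x)) /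
      G (Fin.cons (knotheHead a b F G S.toFun x) (S.toFun (Fin.tail x)))))
    (fun j => S.diag j (Fin.tail x)) : Fin (n + 1) → ℝ) i
  measurable_toFun := measurable_finCons
    (measurable_knotheHead hab hm hF hmF hG hmG S.measurable_toFun)
    (S.measurable_toFun.comp measurable_tail)
  measurable_diag := by
    have h1 := measurable_knotheHead hab hm hF hmF hG hmG S.measurable_toFun
    have h2 := S.measurable_toFun.comp measurable_tail
    refine Fin.cases ?_ fun j => ?_
    · simp only [Fin.cons_zero]
      exact (hF.measurable.div ((continuous_headMarginal hF).measurable.comp measurable_tail)).mul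
        (((continuous_headMarginal hG).measurable.comp h2).div
          (hG.measurable.comp (measurable_finCons h1 h2)))
    · simpa [Function.comp_def] using (S.measurable_diag j).comp measurable_tail
  diag_nonneg := by
    have hba := mul_pos hm (sub_pos.2 hab)
    refine Fin.cases (fun x => ?_) fun j x => ?_
    · have h1 := hm.trans_le (hmF x)
      have h2 := hba.trans_le (le_headMarginal hab.le hF hmF (Fin.tail x))
      have h3 := hba.trans_le (le_headMarginal hab.le hG hmG (S.toFun (Fin.tail x)))
      have h4 := hm.trans_le (hmG
        (Fin.cons (knotheHead a b F G S.toFun x) (S.toFun (Fin.tail x))))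
      simp only [Fin.cons_zero]
      positivity
    · simpa using S.diag_nonneg j _
  diag_bdd := by
    obtain ⟨K, hK⟩ := S.diag_bdd
    have hba := sub_pos.2 hab
    refine ⟨max (M / (m * (b - a)) * (M * (b - a) / m)) K, ?_⟩
    refine Fin.cases (fun x => ?_) fun j x => ?_
    · have hM : 0 < M := hm.trans_le ((hmF x).trans (hFM x))
      refine le_max_of_le_left ?_
      have h3 := (mul_pos hm hba).trans_le (le_headMarginal hab.le hG hmG (S.toFun (Fin.tail x)))
      have h4 := hm.trans_le (hmG
        (Fin.cons (knotheHead a b F G S.toFun x) (S.toFun (Fin.tail x))))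
      simp only [Fin.cons_zero]
      gcongr
      · exact hFM x
      · exact le_headMarginal hab.le hF hmF _
      · exact headMarginal_le hab.le hG hGM _
      · exact hmG _
    · simpa using Or.inr (hK j _)
  hasDerivAt := by
    intro x
    refine Fin.cases ?_ fun j => ?_
    · simp only [Fin.cons_zero, knotheHead, Fin.tail_update_zero, Function.update_self]
      have h := hasDerivAt_monotoneTransport hab hm (continuous_comp_cons hF (Fin.tail x))
        (fun t => hmF _) (continuous_comp_cons hG (S.toFun (Fin.tail x))) (fun t => hmG _) (x 0)
      simp only [Fin.cons_self_tail] at h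
      exact h
    · simp only [Fin.cons_succ, Fin.tail_update_succ]
      exact S.hasDerivAt (Fin.tail x) j
  prod_diag := by
    intro x
    have h2 := (mul_pos hm (sub_pos.2 hab)).trans_le (le_headMarginal hab.le hF hmF (Fin.tail x))
    have h4 := hm.trans_le (hmG
      (Fin.cons (knotheHead a b F G S.toFun x) (S.toFun (Fin.tail x))))
    have h := S.prod_diag (Fin.tail x)
    rw [Fin.prod_univ_succ]
    simp only [Fin.cons_zero, Fin.cons_succ]
    field_simp
    rw [mul_assoc, mul_comm (headMarginal a b G _), h]
  left := by
    intro x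
    refine Fin.cases ?_ fun j => ?_
    · simp only [Fin.cons_zero, knotheHead, Fin.tail_update_zero, Function.update_self]
      exact monotoneTransport_left hab hm (continuous_comp_cons hG _) (fun t => hmG _)
    · simpa only [Fin.cons_succ, Fin.tail_update_succ] using S.left (Fin.tail x) j
  right := by
    intro x
    refine Fin.cases ?_ fun j => ?_
    · simp only [Fin.cons_zero, knotheHead, Fin.tail_update_zero, Function.update_self]
      exact monotoneTransport_right hab hm (continuous_comp_cons hF _) (fun t => hmF _)
        (continuous_comp_cons hG _) (fun t => hmG _)
    · simpa only [Fin.cons_succ, Fin.tail_update_succ] using S.right (Fin.tail x) j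
  lintegral_comp φ hφ := lintegral_knothe_step hab hm hF hmF hG hmG S.measurable_toFun
    S.lintegral_comp hφ

end Step

theorem nonempty_knotheMap {n : ℕ} {a b m M : ℝ} {F G : (Fin n → ℝ) → ℝ} (hab : a < b)
    (hm : 0 < m) (hF : Continuous F) (hmF : ∀ x, m ≤ F x) (hFM : ∀ x, F x ≤ M)
    (hG : Continuous G) (hmG : ∀ x, m ≤ G x) (hGM : ∀ x, G x ≤ M)
    (hFG : ∫ x, F x ∂cubeMeasure n a b = ∫ x, G x ∂cubeMeasure n a b) :
    Nonempty (KnotheMap n a b F G) := by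
  induction n generalizing m M with
  | zero =>
    have h0 : F = G := by
      have hx : ∀ H : (Fin 0 → ℝ) → ℝ, ∫ x, H x ∂cubeMeasure 0 a b = H 0 := fun H => by
        rw [cubeMeasure, Measure.pi_of_empty _ 0, integral_dirac]
      funext x
      rw [hx, hx] at hFG
      rwa [Subsingleton.elim x 0]
    subst h0
    exact ⟨{ toFun := id
             diag := fun _ _ => 0
             measurable_toFun := measurable_id
             measurable_diag := fun i => i.elim0
             diag_nonneg := fun i => i.elim0
             diag_bdd := ⟨0, fun i => i.elim0⟩
             hasDerivAt := fun _ i => i.elim0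
             prod_diag := fun x => by simp
             left := fun _ i => i.elim0
             right := fun _ i => i.elim0
             lintegral_comp := fun _ _ => rfl }⟩
  | succ n ih =>
    obtain ⟨S⟩ := ih (F := headMarginal a b F) (G := headMarginal a b G)
      (mul_pos hm (sub_pos.2 hab)) (continuous_headMarginal hF) (le_headMarginal hab.le hF hmF)
      (headMarginal_le hab.le hF hFM) (continuous_headMarginal hG) (le_headMarginal hab.le hG hmG)
      (headMarginal_le hab.le hG hGM)
      (by rw [integral_headMarginal hab.le hF hmF hFM, integral_headMarginal hab.le hG hmG hGM,
        hFG])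
    exact ⟨S.cons hab hm hF hmF hFM hG hmG hGM⟩

namespace KnotheMap

variable {n : ℕ} {a b : ℝ} {F G : (Fin n → ℝ) → ℝ} (T : KnotheMap n a b F G)

lemma integral_comp (hF : Measurable F) (hF0 : ∀ x, 0 ≤ F x) (hG : Measurable G)
    (hG0 : ∀ x, 0 ≤ G x) {φ : (Fin n → ℝ) → ℝ} (hφ : Measurable φ) (hφ0 : ∀ x, 0 ≤ φ x) :
    ∫ x, φ (T.toFun x) * F x ∂cubeMeasure n a b = ∫ x, φ x * G x ∂cubeMeasure n a b := by
  rw [integral_eq_lintegral_of_nonneg_ae, integral_eq_lintegral_of_nonneg_ae]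
  · simp_rw [ENNReal.ofReal_mul (hφ0 _)]
    rw [T.lintegral_comp _ hφ.ennreal_ofReal]
  · exact Filter.Eventually.of_forall fun x => mul_nonneg (hφ0 x) (hG0 x)
  · exact (hφ.mul hG).aestronglyMeasurable
  · exact Filter.Eventually.of_forall fun x => mul_nonneg (hφ0 _) (hF0 x)
  · exact ((hφ.comp T.measurable_toFun).mul hF).aestronglyMeasurable

lemma mem_Icc {x : Fin n → ℝ} {i : Fin n} (hx : x i ∈ Icc a b) : T.toFun x i ∈ Icc a b := by
  have hmono : Monotone fun t => T.toFun (Function.update x i t) i := by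
    have hd : ∀ t, HasDerivAt (fun t => T.toFun (Function.update x i t) i)
        (T.diag i (Function.update x i t)) t := fun t => by
      simpa using T.hasDerivAt (Function.update x i t) i
    refine monotone_of_deriv_nonneg (fun t => (hd t).differentiableAt) fun t => ?_
    rw [(hd t).deriv]
    exact T.diag_nonneg i _
  have h1 := hmono hx.1
  have h2 := hmono hx.2
  simp only [T.left, T.right, Function.update_eq_self] at h1 h2
  exact ⟨h1, h2⟩

lemma ae_cubeMeasure_mem : ∀ᵐ x ∂cubeMeasure n a b, ∀ i, x i ∈ Icc a b := by
  rw [cubeMeasure, ← Measure.restrict_pi_pi]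
  filter_upwards [ae_restrict_mem (MeasurableSet.univ_pi fun _ => measurableSet_Ioc)] with x hx i
  exact Ioc_subset_Icc_self (hx i (mem_univ i))

lemma ae_abs_le : ∀ᵐ x ∂cubeMeasure n a b, ∀ i, |T.toFun x i| ≤ max |a| |b| := by
  filter_upwards [ae_cubeMeasure_mem] with x hx i
  exact abs_le_max_abs_abs (T.mem_Icc (hx i)).1 (T.mem_Icc (hx i)).2

lemma card_mul_rpow_le (hn : n ≠ 0) (hF0 : ∀ x, 0 < F x) (hG0 : ∀ x, 0 < G x) (x : Fin n → ℝ) :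
    n * (G (T.toFun x) ^ (-(1 / (n : ℝ))) * F x) ≤
      ∑ i, F x ^ (1 - 1 / (n : ℝ)) * T.diag i x := by
  have hn' : (0 : ℝ) < n := by positivity
  have hP : 0 ≤ ∏ i, T.diag i x := Finset.prod_nonneg fun i _ => T.diag_nonneg i x
  have hamgm : n * (∏ i, T.diag i x) ^ (1 / (n : ℝ)) ≤ ∑ i, T.diag i x := by
    have h := Real.geom_mean_le_arith_mean_weighted Finset.univ (fun _ : Fin n => 1 / (n : ℝ))
      (fun i => T.diag i x) (fun _ _ => by positivity) (by simp [hn])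
      (fun i _ => T.diag_nonneg i x)
    rw [Real.finsetProd_rpow _ _ fun i _ => T.diag_nonneg i x, ← Finset.mul_sum] at h
    calc _ ≤ n * (1 / (n : ℝ) * ∑ i, T.diag i x) := by gcongr
      _ = _ := by field_simp
  have hprod : ∏ i, T.diag i x = F x / G (T.toFun x) := by
    rw [← T.prod_diag x, mul_div_cancel_right₀ _ (hG0 _).ne']
  have key : G (T.toFun x) ^ (-(1 / (n : ℝ))) * F x =
      F x ^ (1 - 1 / (n : ℝ)) * (∏ i, T.diag i x) ^ (1 / (n : ℝ)) := by
    rw [hprod, Real.div_rpow (hF0 x).le (hG0 _).le, Real.rpow_neg (hG0 _).le, ← mul_div_assoc,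
      ← Real.rpow_add (hF0 x), sub_add_cancel, Real.rpow_one, inv_mul_eq_div]
  rw [key, ← Finset.mul_sum, mul_left_comm]
  exact mul_le_mul_of_nonneg_left hamgm (Real.rpow_nonneg (hF0 x).le _)

lemma integrable_mul_diag {h : (Fin n → ℝ) → ℝ} (hh : Measurable h) {M : ℝ}
    (hM : ∀ x, |h x| ≤ M) (i : Fin n) :
    Integrable (fun x => h x * T.diag i x) (cubeMeasure n a b) := by
  obtain ⟨K, hK⟩ := T.diag_bdd
  refine integrable_cubeMeasure_of_bound (M := M * K) (hh.mul (T.measurable_diag i)) fun x => ?_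
  rw [abs_mul, abs_of_nonneg (T.diag_nonneg i x)]
  exact mul_le_mul (hM x) (hK i x) (T.diag_nonneg i x) ((abs_nonneg _).trans (hM x))

lemma integrable_mul_toFun {h : (Fin n → ℝ) → ℝ} (hh : Measurable h) {M : ℝ}
    (hM : ∀ x, |h x| ≤ M) (i : Fin n) :
    Integrable (fun x => h x * T.toFun x i) (cubeMeasure n a b) := by
  refine Integrable.of_bound (C := M * max |a| |b|) (hh.mul
    ((measurable_pi_apply i).comp T.measurable_toFun)).aestronglyMeasurable ?_
  filter_upwards [T.ae_abs_le] with x hx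
  rw [Real.norm_eq_abs, abs_mul]
  exact mul_le_mul (hM x) (hx i) (abs_nonneg _) ((abs_nonneg _).trans (hM x))

lemma card_mul_integral_rpow_le (hn : n ≠ 0) {m M : ℝ} (hm : 0 < m) (hF : Measurable F)
    (hmF : ∀ x, m ≤ F x) (hFM : ∀ x, F x ≤ M) (hG : Measurable G) (hmG : ∀ x, m ≤ G x) :
    n * ∫ x, G x ^ (1 - 1 / (n : ℝ)) ∂cubeMeasure n a b ≤
      ∑ i, ∫ x, F x ^ (1 - 1 / (n : ℝ)) * T.diag i x ∂cubeMeasure n a b := by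
  have hF0 : ∀ x, 0 < F x := fun x => hm.trans_le (hmF x)
  have hG0 : ∀ x, 0 < G x := fun x => hm.trans_le (hmG x)
  have hn1 : (1 : ℝ) ≤ n := by exact_mod_cast Nat.one_le_iff_ne_zero.2 hn
  have hs : 0 ≤ 1 - 1 / (n : ℝ) := by
    rw [sub_nonneg, div_le_one (by linarith)]; exact hn1
  have hint : ∀ i, Integrable (fun x => F x ^ (1 - 1 / (n : ℝ)) * T.diag i x)
      (cubeMeasure n a b) := fun i => by
    refine T.integrable_mul_diag (M := M ^ (1 - 1 / (n : ℝ))) (hF.pow_const _) (fun x => ?_) i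
    rw [abs_of_nonneg (Real.rpow_nonneg (hF0 x).le _)]
    exact Real.rpow_le_rpow (hF0 x).le (hFM x) hs
  have h1 : ∫ x, G x ^ (1 - 1 / (n : ℝ)) ∂cubeMeasure n a b =
      ∫ x, G (T.toFun x) ^ (-(1 / (n : ℝ))) * F x ∂cubeMeasure n a b := by
    rw [T.integral_comp hF (fun x => (hF0 x).le) hG (fun x => (hG0 x).le)
      (φ := fun x => G x ^ (-(1 / (n : ℝ)))) (hG.pow_const _)
      (fun x => Real.rpow_nonneg (hG0 x).le _)]
    refine integral_congr_ae (Filter.Eventually.of_forall fun x => ?_)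
    simp only
    rw [sub_eq_neg_add, Real.rpow_add (hG0 x), Real.rpow_one]
  rw [h1, ← integral_const_mul, ← integral_finsetSum _ fun i _ => hint i]
  refine integral_mono_of_nonneg (Filter.Eventually.of_forall fun x => ?_)
    (integrable_finsetSum _ fun i _ => hint i)
    (Filter.Eventually.of_forall fun x => T.card_mul_rpow_le hn hF0 hG0 x)
  have := hF0 x
  have := hG0 (T.toFun x)
  simp only [Pi.zero_apply]
  positivity

/-- Integration by parts against one component of a triangular transport map. -/
lemma integral_mul_diag (hab : a ≤ b) {h h' : (Fin n → ℝ) → ℝ} {M M' e : ℝ} (i : Fin n)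
    (hh : Measurable h) (hM : ∀ x, |h x| ≤ M) (hh' : Measurable h') (hM' : ∀ x, |h' x| ≤ M')
    (hderiv : ∀ x, HasDerivAt (fun t => h (Function.update x i t)) (h' x) (x i))
    (ha : ∀ x, h (Function.update x i a) = e) (hb : ∀ x, h (Function.update x i b) = e) :
    ∫ x, h x * T.diag i x ∂cubeMeasure n a b =
      e * (cubeMeasure n a b).real univ - ∫ x, h' x * T.toFun x i ∂cubeMeasure n a b := by
  have hI1 := T.integrable_mul_diag hh hM i
  have hI2 := T.integrable_mul_toFun hh' hM' i
  have hconst : e * (cubeMeasure n a b).real univ = ∫ _, e ∂cubeMeasure n a b := by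
    rw [integral_const, smul_eq_mul, mul_comm]
  rw [hconst, ← integral_sub (integrable_const e) hI2]
  cases n with
  | zero => exact i.elim0
  | succ k =>
    have hI3 : Integrable (fun x => e - h' x * T.toFun x i) (cubeMeasure (k + 1) a b) :=
      (integrable_const e).sub hI2
    rw [integral_cubeMeasure_succ i hI1, integral_cubeMeasure_succ i hI3]
    refine integral_congr_ae (Filter.Eventually.of_forall fun y => ?_)
    have hins : Measurable fun t : ℝ => (i.insertNth t y : Fin (k + 1) → ℝ) :=
      (Continuous.finInsertNth (A := fun _ => ℝ) i continuous_id continuous_const).measurable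
    have hd1 : ∀ t, HasDerivAt (fun s => h (i.insertNth s y)) (h' (i.insertNth t y)) t := by
      intro t
      have := hderiv (i.insertNth t y)
      simpa only [Fin.update_insertNth, Fin.insertNth_apply_same] using this
    have hd2 : ∀ t, HasDerivAt (fun s => T.toFun (i.insertNth s y) i)
        (T.diag i (i.insertNth t y)) t := by
      intro t
      have := T.hasDerivAt (i.insertNth t y) i
      simpa only [Fin.update_insertNth, Fin.insertNth_apply_same] using this
    have hi1 : IntervalIntegrable (fun t => h' (i.insertNth t y)) volume a b := by
      rw [intervalIntegrable_iff_integrableOn_Ioc_of_le hab]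
      exact Integrable.of_bound (C := M') (hh'.comp hins).aestronglyMeasurable
        (Filter.Eventually.of_forall fun t => hM' _)
    have hi2 : IntervalIntegrable (fun t => T.diag i (i.insertNth t y)) volume a b := by
      obtain ⟨K, hK⟩ := T.diag_bdd
      rw [intervalIntegrable_iff_integrableOn_Ioc_of_le hab]
      refine Integrable.of_bound (C := K) ((T.measurable_diag i).comp hins).aestronglyMeasurable
        (Filter.Eventually.of_forall fun t => ?_)
      rw [Real.norm_eq_abs, abs_of_nonneg (T.diag_nonneg i _)]
      exact hK i _
    have hibp := intervalIntegral.integral_mul_deriv_eq_deriv_mul (fun t _ => hd1 t)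
      (fun t _ => hd2 t) hi1 hi2
    have hupd : ∀ t, (i.insertNth t y : Fin (k + 1) → ℝ) =
        Function.update (i.insertNth a y) i t := fun t => by rw [Fin.update_insertNth]
    have hTc : Continuous fun t => T.toFun (i.insertNth t y) i :=
      continuous_iff_continuousAt.2 fun t => (hd2 t).continuousAt
    have hi3 : IntervalIntegrable (fun t => h' (i.insertNth t y) * T.toFun (i.insertNth t y) i)
        volume a b := hi1.mul_continuousOn hTc.continuousOn
    simp only [← intervalIntegral.integral_of_le hab]
    rw [hibp, intervalIntegral.integral_sub (by simp) hi3, hupd b, hupd a, ha, hb, T.left, T.right]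
    simp
    ring

end KnotheMap

lemma hasDerivAt_abs_rpow_add_rpow {r ε : ℝ} (hr : 1 < r) (hε : 0 < ε) (s w : ℝ) :
    HasDerivAt (fun w => (|w| ^ r + ε) ^ s)
      (r * |w| ^ (r - 2) * w * s * (|w| ^ r + ε) ^ (s - 1)) w := by
  have hpos : 0 < |w| ^ r + ε := by positivity
  exact ((hasDerivAt_abs_rpow w hr).add_const ε).rpow_const (Or.inl hpos.ne')

lemma abs_deriv_abs_rpow_add_rpow_le {r ε s t : ℝ} (hr : 1 < r) (hε : 0 < ε) (hs : 0 ≤ s)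
    (ht : t = s - 1 / r) (w : ℝ) :
    |r * |w| ^ (r - 2) * w * s * (|w| ^ r + ε) ^ (s - 1)| ≤ s * r * (|w| ^ r + ε) ^ t := by
  have hr0 : 0 < r := by linarith
  have hpos : 0 < |w| ^ r + ε := by positivity
  have h1 : |w| ^ (r - 2) * |w| ≤ (|w| ^ r + ε) ^ (1 - 1 / r) := by
    rcases eq_or_ne w 0 with rfl | hw
    · simp only [abs_zero, mul_zero]; positivity
    · have hw' : 0 < |w| := abs_pos.2 hw
      have h2 : |w| ^ (r - 2) * |w| = (|w| ^ r) ^ (1 - 1 / r) := by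
        rw [← Real.rpow_mul hw'.le, ← Real.rpow_add_one hw'.ne']
        congr 1
        field_simp
        ring
      rw [h2]
      refine Real.rpow_le_rpow (by positivity) (by linarith) ?_
      rw [sub_nonneg, div_le_one hr0]; exact hr.le
  have h3 : (|w| ^ r + ε) ^ t = (|w| ^ r + ε) ^ (1 - 1 / r) * (|w| ^ r + ε) ^ (s - 1) := by
    rw [← Real.rpow_add hpos, ht]; congr 1; ring
  rw [abs_mul, abs_mul, abs_mul, abs_mul, abs_of_pos hr0, abs_of_nonneg hs, abs_of_nonneg
    (Real.rpow_nonneg (abs_nonneg w) _), abs_of_nonneg (Real.rpow_nonneg hpos.le (s - 1)), h3]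
  calc _ = s * r * ((|w| ^ (r - 2) * |w|) * (|w| ^ r + ε) ^ (s - 1)) := by ring
    _ ≤ _ := by gcongr

lemma hasDerivAt_comp_toLp_update {n : ℕ} {u : EuclideanSpace ℝ (Fin n) → ℝ}
    (hu : Differentiable ℝ u) (x : Fin n → ℝ) (i : Fin n) :
    HasDerivAt (fun t => u (WithLp.toLp 2 (Function.update x i t)))
      (fderiv ℝ u (WithLp.toLp 2 x) (EuclideanSpace.single i 1)) (x i) := by
  have h1 : HasDerivAt (fun t : ℝ => WithLp.toLp 2 (Function.update x i t))
      (EuclideanSpace.single i (1 : ℝ)) (x i) := by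
    have := (PiLp.hasStrictFDerivAt_toLp (𝕜 := ℝ) 2 (E := fun _ : Fin n => ℝ)
      (Function.update x i (x i))).hasFDerivAt.comp_hasDerivAt (x i)
      (hasDerivAt_update x i (x i))
    exact this
  have h2 := (hu (WithLp.toLp 2 (Function.update x i (x i)))).hasFDerivAt.comp_hasDerivAt (x i) h1
  rw [Function.update_eq_self] at h2
  exact h2

lemma sum_fderiv_single_mul {n : ℕ} (L : EuclideanSpace ℝ (Fin n) →L[ℝ] ℝ) (y : Fin n → ℝ) :
    ∑ i, L (EuclideanSpace.single i 1) * y i = L (WithLp.toLp 2 y) := by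
  have h := (EuclideanSpace.basisFun (Fin n) ℝ).sum_repr (WithLp.toLp 2 y)
  conv_rhs => rw [← h]
  simp [mul_comm]

lemma comp_toLp_eq_zero {n : ℕ} {u : EuclideanSpace ℝ (Fin n) → ℝ} {R : ℝ}
    (hu : ∀ x, R ≤ ‖x‖ → u x = 0) {x : Fin n → ℝ} {i : Fin n} (hx : R ≤ |x i|) :
    u (WithLp.toLp 2 x) = 0 :=
  hu _ (hx.trans (PiLp.norm_apply_le (WithLp.toLp 2 x) i))

lemma norm_toLp_le_of_abs_le {n : ℕ} {R : ℝ} {x : Fin n → ℝ} (hx : ∀ i, |x i| ≤ R) :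
    ‖WithLp.toLp 2 x‖ ≤ n * R := by
  have h := (EuclideanSpace.basisFun (Fin n) ℝ).sum_repr (WithLp.toLp 2 x)
  rw [← h]
  refine (norm_sum_le _ _).trans ?_
  calc _ ≤ ∑ _i : Fin n, R := by
        refine Finset.sum_le_sum fun i _ => ?_
        simpa [norm_smul] using hx i
    _ = _ := by simp

/-- The mass transport inequality behind the sharp Sobolev inequality, on a cube. -/
theorem card_mul_integral_rpow_le_of_hasCompactSupport {n : ℕ} (hn : 2 ≤ n) {p q r : ℝ}
    (hpq : p.HolderConjugate q) (hr : 1 < r) (hrp : 1 / r = 1 / p - 1 / n)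
    {u : EuclideanSpace ℝ (Fin n) → ℝ} (hu : ContDiff ℝ 1 u) (huc : HasCompactSupport u)
    {R ε m M : ℝ} (hR : 0 < R) (huR : ∀ x, R ≤ ‖x‖ → u x = 0) (hε : 0 < ε)
    {G : (Fin n → ℝ) → ℝ} (hm : 0 < m) (hG : Continuous G) (hmG : ∀ x, m ≤ G x)
    (hGM : ∀ x, G x ≤ M)
    (hFG : ∫ x, (|u (WithLp.toLp 2 x)| ^ r + ε) ∂cubeMeasure n (-R) R =
      ∫ x, G x ∂cubeMeasure n (-R) R) :
    n * ∫ x, G x ^ (1 - 1 / (n : ℝ)) ∂cubeMeasure n (-R) R ≤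
      n * (ε ^ (1 - 1 / (n : ℝ)) * (cubeMeasure n (-R) R).real univ) +
      (1 - 1 / (n : ℝ)) * r *
        ((∫ x, ‖fderiv ℝ u (WithLp.toLp 2 x)‖ ^ p ∂cubeMeasure n (-R) R) ^ (1 / p) *
        (∫ x, ‖WithLp.toLp 2 x‖ ^ q * G x ∂cubeMeasure n (-R) R) ^ (1 / q)) := by
  have hn0 : (0 : ℝ) < n := by positivity
  have hn1 : (1 : ℝ) ≤ n := by exact_mod_cast (by omega : 1 ≤ n)
  set s : ℝ := 1 - 1 / (n : ℝ) with hs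
  have hs0 : 0 ≤ s := by rw [hs, sub_nonneg, div_le_one hn0]; exact hn1
  have hq : 1 / q = s - 1 / r := by
    rw [hs, hrp, one_div q, one_div p, ← hpq.one_sub_inv]; ring
  have hq0 : 0 < q := hpq.symm.pos
  have hcL : Continuous (fun x : Fin n → ℝ => WithLp.toLp 2 x) := PiLp.continuous_toLp 2 _
  have hcfd : Continuous (fderiv ℝ u) := hu.continuous_fderiv one_ne_zero
  obtain ⟨K, hK⟩ := hu.continuous.bounded_above_of_compact_support huc
  obtain ⟨K', hK'⟩ := hcfd.bounded_above_of_compact_support (huc.fderiv ℝ)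
  set μ := cubeMeasure n (-R) R with hμ
  set v : (Fin n → ℝ) → ℝ := fun x => u (WithLp.toLp 2 x) with hv
  have hvc : Continuous v := hu.continuous.comp hcL
  set F : (Fin n → ℝ) → ℝ := fun x => |v x| ^ r + ε with hF
  have hFc : Continuous F :=
    (hvc.abs.rpow_const fun _ => Or.inr (by linarith)).add continuous_const
  have hFε : ∀ x, ε ≤ F x := fun x => le_add_of_nonneg_left (by positivity)
  have hF0 : ∀ x, 0 < F x := fun x => hε.trans_le (hFε x)
  have hFK : ∀ x, F x ≤ K ^ r + ε := fun x => by
    have : |v x| ≤ K := hK _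
    simp only [hF]
    gcongr
  obtain ⟨T⟩ := nonempty_knotheMap (a := -R) (b := R) (m := min m ε) (M := max M (K ^ r + ε))
    (F := F) (G := G) (by linarith) (lt_min hm hε) hFc
    (fun x => (min_le_right _ _).trans (hFε x)) (fun x => (hFK x).trans (le_max_right _ _)) hG
    (fun x => (min_le_left _ _).trans (hmG x)) (fun x => (hGM x).trans (le_max_left _ _)) hFG
  have hH' : ∀ x, |r * |v x| ^ (r - 2) * v x * s * F x ^ (s - 1)| ≤ s * r * F x ^ (1 / q) :=
    fun x => abs_deriv_abs_rpow_add_rpow_le hr hε hs0 hq (v x)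
  set h' : Fin n → (Fin n → ℝ) → ℝ := fun i x =>
    r * |v x| ^ (r - 2) * v x * s * F x ^ (s - 1) *
      fderiv ℝ u (WithLp.toLp 2 x) (EuclideanSpace.single i 1) with hh'
  have hh'm : ∀ i, Measurable (h' i) := fun i => by
    have h1 : Measurable fun x => fderiv ℝ u (WithLp.toLp 2 x) (EuclideanSpace.single i 1) :=
      ((hcfd.comp hcL).clm_apply continuous_const).measurable
    have h2 := hvc.measurable
    have h3 := hFc.measurable
    fun_prop
  have hFq : ∀ x, F x ^ (1 / q) ≤ (K ^ r + ε) ^ (1 / q) := fun x =>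
    Real.rpow_le_rpow (hF0 x).le (hFK x) (by positivity)
  have hh'b : ∀ i x, |h' i x| ≤ s * r * (K ^ r + ε) ^ (1 / q) * K' := fun i x => by
    rw [hh', abs_mul]
    have h1 : |fderiv ℝ u (WithLp.toLp 2 x) (EuclideanSpace.single i 1)| ≤ K' := by
      refine ((fderiv ℝ u (WithLp.toLp 2 x)).le_opNorm _).trans ?_
      simpa using hK' (WithLp.toLp 2 x)
    refine mul_le_mul ((hH' x).trans ?_) h1 (abs_nonneg _) ?_
    · gcongr
      exact hFK x
    · have : 0 ≤ (K ^ r + ε) ^ (1 / q) := (Real.rpow_nonneg (hF0 x).le _).trans (hFq x)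
      positivity
  have hibp : ∀ i, ∫ x, F x ^ s * T.diag i x ∂μ =
      ε ^ s * μ.real univ - ∫ x, h' i x * T.toFun x i ∂μ := fun i => by
    have hface : ∀ (x : Fin n → ℝ) (t : ℝ), |t| = R → F (Function.update x i t) ^ s = ε ^ s := by
      intro x t ht
      have : v (Function.update x i t) = 0 :=
        comp_toLp_eq_zero huR (i := i) (by rw [Function.update_self, ht])
      simp [hF, this, (by linarith : r ≠ 0)]
    refine T.integral_mul_diag (by linarith) (h := fun x => F x ^ s) (h' := h' i)
      (M := (K ^ r + ε) ^ s) (e := ε ^ s) i (hFc.measurable.pow_const _) (fun x => ?_)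
      (hh'm i) (hh'b i) (fun x => ?_) (fun x => hface x _ (by simp [abs_of_pos hR]))
      (fun x => hface x _ (abs_of_pos hR))
    · rw [abs_of_nonneg (Real.rpow_nonneg (hF0 x).le _)]
      exact Real.rpow_le_rpow (hF0 x).le (hFK x) hs0
    · have h1 := hasDerivAt_comp_toLp_update (hu.differentiable one_ne_zero) x i
      have h2 := hasDerivAt_abs_rpow_add_rpow hr hε s (u (WithLp.toLp 2
        (Function.update x i (x i))))
      have h3 := h2.comp (x i) h1
      rw [Function.update_eq_self] at h3
      exact h3
  have hmain := T.card_mul_integral_rpow_le (by omega) (lt_min hm hε) hFc.measurable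
    (fun x => (min_le_right _ _).trans (hFε x)) hFK hG.measurable
    (fun x => (min_le_left _ _).trans (hmG x))
  rw [Finset.sum_congr rfl fun i _ => hibp i, Finset.sum_sub_distrib, Finset.sum_const,
    Finset.card_univ, Fintype.card_fin, nsmul_eq_mul,
    ← integral_finsetSum _ fun i _ => T.integrable_mul_toFun (hh'm i) (hh'b i) i] at hmain
  refine hmain.trans ?_
  rw [sub_eq_add_neg, ← integral_neg]
  gcongr
  have hTm : Measurable fun x => ‖WithLp.toLp 2 (T.toFun x)‖ :=
    (hcL.norm.measurable).comp T.measurable_toFun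
  have hTb : ∀ᵐ x ∂μ, ‖WithLp.toLp 2 (T.toFun x)‖ ≤ n * R := by
    filter_upwards [T.ae_abs_le] with x hx
    exact norm_toLp_le_of_abs_le fun i => (hx i).trans (by simp [abs_of_pos hR])
  set f : (Fin n → ℝ) → ℝ := fun x => ‖fderiv ℝ u (WithLp.toLp 2 x)‖ with hf
  set g : (Fin n → ℝ) → ℝ := fun x => F x ^ (1 / q) * ‖WithLp.toLp 2 (T.toFun x)‖ with hg
  have hfm : Measurable f := (hcfd.comp hcL).norm.measurable
  have hgm : Measurable g := (hFc.measurable.pow_const _).mul hTm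
  have hgb : ∀ᵐ x ∂μ, ‖g x‖ ≤ (K ^ r + ε) ^ (1 / q) * (n * R) := by
    filter_upwards [hTb] with x hx
    rw [hg, Real.norm_eq_abs, abs_mul, abs_of_nonneg (Real.rpow_nonneg (hF0 x).le _),
      abs_of_nonneg (norm_nonneg _)]
    exact mul_le_mul (hFq x) hx (norm_nonneg _)
      ((Real.rpow_nonneg (hF0 x).le _).trans (hFq x))
  have hfb : ∀ x, ‖f x‖ ≤ K' := fun x => by simpa [hf] using hK' (WithLp.toLp 2 x)
  have hfL : MemLp f (ENNReal.ofReal p) μ :=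
    MemLp.of_bound hfm.aestronglyMeasurable K' (Filter.Eventually.of_forall hfb)
  have hgL : MemLp g (ENNReal.ofReal q) μ := MemLp.of_bound hgm.aestronglyMeasurable _ hgb
  have hholder := integral_mul_le_Lp_mul_Lq_of_nonneg hpq (μ := μ) (f := f) (g := g)
    (Filter.Eventually.of_forall fun x => norm_nonneg _)
    (Filter.Eventually.of_forall fun x =>
      mul_nonneg (Real.rpow_nonneg (hF0 x).le _) (norm_nonneg _)) hfL hgL
  have hgq : ∫ x, g x ^ q ∂μ = ∫ x, ‖WithLp.toLp 2 x‖ ^ q * G x ∂μ := by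
    rw [← T.integral_comp hFc.measurable (fun x => (hF0 x).le) hG.measurable
      (fun x => hm.le.trans (hmG x)) (φ := fun x => ‖WithLp.toLp 2 x‖ ^ q)
      (hcL.norm.measurable.pow_const _) (fun x => by positivity)]
    refine integral_congr_ae (Filter.Eventually.of_forall fun x => ?_)
    simp only [hg]
    rw [Real.mul_rpow (Real.rpow_nonneg (hF0 x).le _) (norm_nonneg _), ← Real.rpow_mul (hF0 x).le,
      one_div_mul_cancel hq0.ne', Real.rpow_one, mul_comm]
  rw [hgq] at hholder
  calc ∫ x, -∑ i, h' i x * T.toFun x i ∂μ ≤ ∫ x, s * r * (f x * g x) ∂μ := by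
        refine integral_mono_ae ?_ ?_ (Filter.Eventually.of_forall fun x => ?_)
        · exact (integrable_finsetSum _ fun i _ =>
            T.integrable_mul_toFun (hh'm i) (hh'b i) i).neg
        · refine Integrable.const_mul ?_ _
          refine Integrable.of_bound (C := K' * ((K ^ r + ε) ^ (1 / q) * (n * R)))
            (hfm.mul hgm).aestronglyMeasurable ?_
          filter_upwards [hgb] with x hx
          rw [norm_mul]
          exact mul_le_mul (hfb x) hx (norm_nonneg _) ((norm_nonneg _).trans (hfb x))
        · simp only [hh', mul_assoc (_ * F x ^ (s - 1))]
          rw [← Finset.mul_sum, sum_fderiv_single_mul]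
          refine (neg_le_abs _).trans ?_
          rw [abs_mul]
          calc _ ≤ s * r * F x ^ (1 / q) * (f x * ‖WithLp.toLp 2 (T.toFun x)‖) :=
                mul_le_mul (hH' x) ((fderiv ℝ u (WithLp.toLp 2 x)).le_opNorm _) (abs_nonneg _)
                  (by have := hF0 x; positivity)
            _ = _ := by rw [hg]; ring
    _ = s * r * ∫ x, f x * g x ∂μ := integral_const_mul _ _
    _ ≤ _ := by gcongr

/-- The cube `(a, b]ⁿ` in Euclidean space. -/
def euclideanCube (n : ℕ) (a b : ℝ) : Set (EuclideanSpace ℝ (Fin n)) :=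
  {x | ∀ i, x i ∈ Ioc a b}

lemma euclideanCube_subset {n : ℕ} {a b a' b' : ℝ} (ha : a' ≤ a) (hb : b ≤ b') :
    euclideanCube n a b ⊆ euclideanCube n a' b' :=
  fun _ hx i => Ioc_subset_Ioc ha hb (hx i)

lemma measurableSet_euclideanCube (n : ℕ) (a b : ℝ) : MeasurableSet (euclideanCube n a b) := by
  have : euclideanCube n a b = ⋂ i, {x : EuclideanSpace ℝ (Fin n) | x i ∈ Ioc a b} := by
    ext; simp [euclideanCube]
  rw [this]
  exact MeasurableSet.iInter fun i =>
    (EuclideanSpace.proj (𝕜 := ℝ) i).continuous.measurable measurableSet_Ioc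

lemma integral_cubeMeasure_comp_toLp {n : ℕ} {a b : ℝ} (f : EuclideanSpace ℝ (Fin n) → ℝ) :
    ∫ x, f (WithLp.toLp 2 x) ∂cubeMeasure n a b = ∫ x in euclideanCube n a b, f x := by
  rw [cubeMeasure, ← Measure.restrict_pi_pi, ← volume_pi]
  rw [← (PiLp.volume_preserving_toLp (Fin n)).setIntegral_preimage_emb
    (MeasurableEquiv.toLp 2 (Fin n → ℝ)).measurableEmbedding]
  congr 2
  ext x
  simp [euclideanCube, mem_pi]

lemma exists_euclideanCube_subset {n : ℕ} {R : ℝ} {x : EuclideanSpace ℝ (Fin n)}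
    (hx : ‖x‖ < R) : x ∈ euclideanCube n (-R) R := fun i => by
  have h := (PiLp.norm_apply_le x i).trans_lt hx
  exact Ioo_subset_Ioc_self (abs_lt.1 h)

lemma tendsto_setIntegral_euclideanCube {n : ℕ} {f : EuclideanSpace ℝ (Fin n) → ℝ}
    (hf : Integrable f) :
    Filter.Tendsto (fun k : ℕ => ∫ x in euclideanCube n (-k) k, f x) Filter.atTop
      (nhds (∫ x, f x)) := by
  have hU : ⋃ k : ℕ, euclideanCube n (-k) k = univ := by
    refine eq_univ_of_forall fun x => ?_
    obtain ⟨k, hk⟩ := exists_nat_gt ‖x‖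
    exact mem_iUnion.2 ⟨k, exists_euclideanCube_subset hk⟩
  have h := tendsto_setIntegral_of_monotone (μ := volume) (f := f)
    (s := fun k : ℕ => euclideanCube n (-k) k) (fun k => measurableSet_euclideanCube n _ _)
    (fun k l hkl => euclideanCube_subset (by simpa using hkl) (by simpa using hkl))
    (by rw [hU]; exact hf.integrableOn)
  rwa [hU, setIntegral_univ] at h

lemma cubeMeasure_real_univ_pos {n : ℕ} {R : ℝ} (hR : 0 < R) :
    0 < (cubeMeasure n (-R) R).real univ := by
  rw [measureReal_def, Measure.pi_univ]
  simp only [MeasurableSet.univ, Measure.restrict_apply, univ_inter, Real.volume_Ioc,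
    Finset.prod_const, Finset.card_univ, Fintype.card_fin, ENNReal.toReal_pow]
  rw [ENNReal.toReal_ofReal (by linarith)]
  exact pow_pos (by linarith) _

/-- Transport of a compactly supported function to the truncation of the extremal to a cube. -/
lemma card_mul_integral_truncated_le {n : ℕ} (hn : 2 ≤ n) {p q r : ℝ}
    (hpq : p.HolderConjugate q) (hr : 1 < r) (hrp : 1 / r = 1 / p - 1 / n)
    {u : EuclideanSpace ℝ (Fin n) → ℝ} (hu : ContDiff ℝ 1 u) (huc : HasCompactSupport u)
    {R ε : ℝ} (hR : 0 < R) (huR : ∀ x, R ≤ ‖x‖ → u x = 0) (hε : 0 < ε) {U I : ℝ}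
    (hU : U = ∫ x, |u (WithLp.toLp 2 x)| ^ r ∂cubeMeasure n (-R) R)
    (hI : I = ∫ x, (1 + ‖WithLp.toLp 2 x‖ ^ q) ^ (-(n : ℝ)) ∂cubeMeasure n (-R) R) (hI0 : 0 < I) :
    n * (((U + ε * (cubeMeasure n (-R) R).real univ) / I) ^ (1 - 1 / (n : ℝ)) *
      ∫ x, (1 + ‖WithLp.toLp 2 x‖ ^ q) ^ (1 - (n : ℝ)) ∂cubeMeasure n (-R) R) ≤
      n * (ε ^ (1 - 1 / (n : ℝ)) * (cubeMeasure n (-R) R).real univ) +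
      (1 - 1 / (n : ℝ)) * r *
        ((∫ x, ‖fderiv ℝ u (WithLp.toLp 2 x)‖ ^ p ∂cubeMeasure n (-R) R) ^ (1 / p) *
        ((U + ε * (cubeMeasure n (-R) R).real univ) / I *
          ∫ x, ‖WithLp.toLp 2 x‖ ^ q * (1 + ‖WithLp.toLp 2 x‖ ^ q) ^ (-(n : ℝ))
            ∂cubeMeasure n (-R) R) ^ (1 / q)) := by
  set μ := cubeMeasure n (-R) R with hμ
  have hn0 : (0 : ℝ) < n := by positivity
  have hq0 : 0 < q := hpq.symm.pos
  have hcL : Continuous (fun x : Fin n → ℝ => WithLp.toLp 2 x) := PiLp.continuous_toLp 2 _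
  have hU0 : 0 ≤ U := by rw [hU]; positivity
  have hV := cubeMeasure_real_univ_pos (n := n) hR
  set c : ℝ := (U + ε * μ.real univ) / I with hc
  have hc0 : 0 < c := by rw [hc]; positivity
  set ρ : (Fin n → ℝ) → ℝ := fun x => min ‖WithLp.toLp 2 x‖ (n * R) with hρ
  have hρ0 : ∀ x, 0 ≤ ρ x := fun x => le_min (norm_nonneg _) (by positivity)
  have hρc : Continuous ρ := hcL.norm.min continuous_const
  have hρae : ∀ᵐ x ∂μ, ρ x = ‖WithLp.toLp 2 x‖ := by
    filter_upwards [KnotheMap.ae_cubeMeasure_mem] with x hx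
    exact min_eq_left (norm_toLp_le_of_abs_le fun i => abs_le.2 (hx i))
  have hpos : ∀ x, 0 < 1 + ρ x ^ q := fun x => by
    have := Real.rpow_nonneg (hρ0 x) q; linarith
  have hGc : Continuous fun x => c * (1 + ρ x ^ q) ^ (-(n : ℝ)) :=
    continuous_const.mul ((continuous_const.add (hρc.rpow_const fun _ => Or.inr hq0.le)).rpow_const
      fun x => Or.inl (hpos x).ne')
  have hGint : ∀ k : ℝ, ∫ x, (1 + ρ x ^ q) ^ k ∂μ =
      ∫ x, (1 + ‖WithLp.toLp 2 x‖ ^ q) ^ k ∂μ := fun k => by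
    refine integral_congr_ae ?_
    filter_upwards [hρae] with x hx
    rw [hx]
  obtain ⟨K, hK⟩ := hu.continuous.bounded_above_of_compact_support huc
  have hint : Integrable (fun x => |u (WithLp.toLp 2 x)| ^ r) μ := by
    refine integrable_cubeMeasure_of_bound (M := K ^ r)
      ((hu.continuous.comp hcL).abs.measurable.pow_const r) fun x => ?_
    rw [abs_of_nonneg (by positivity)]
    exact Real.rpow_le_rpow (abs_nonneg _) (hK _) (by linarith)
  have h := card_mul_integral_rpow_le_of_hasCompactSupport hn hpq hr hrp hu huc hR huR hε
    (G := fun x => c * (1 + ρ x ^ q) ^ (-(n : ℝ)))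
    (m := c * (1 + (n * R) ^ q) ^ (-(n : ℝ))) (M := c) (by positivity) hGc
    (fun x => by
      have := hpos x
      gcongr ?_ * ?_
      refine Real.rpow_le_rpow_of_nonpos this ?_ (by linarith)
      gcongr
      exact min_le_right _ _)
    (fun x => mul_le_of_le_one_right hc0.le (Real.rpow_le_one_of_one_le_of_nonpos
      (by have := Real.rpow_nonneg (hρ0 x) q; linarith) (by linarith)))
    (by
      rw [integral_add hint (integrable_const _), ← hU, integral_const, integral_const_mul, hGint,
        ← hI, hc, div_mul_cancel₀ _ hI0.ne', smul_eq_mul, mul_comm])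
  have e1 : ∫ x, (c * (1 + ρ x ^ q) ^ (-(n : ℝ))) ^ (1 - 1 / (n : ℝ)) ∂μ =
      c ^ (1 - 1 / (n : ℝ)) * ∫ x, (1 + ‖WithLp.toLp 2 x‖ ^ q) ^ (1 - (n : ℝ)) ∂μ := by
    rw [← hGint, ← integral_const_mul]
    refine integral_congr_ae (Filter.Eventually.of_forall fun x => ?_)
    simp only
    rw [Real.mul_rpow hc0.le (Real.rpow_nonneg (hpos x).le _), ← Real.rpow_mul (hpos x).le]
    congr 2
    field_simp
    ring
  have e2 : ∫ x, ‖WithLp.toLp 2 x‖ ^ q * (c * (1 + ρ x ^ q) ^ (-(n : ℝ))) ∂μ =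
      c * ∫ x, ‖WithLp.toLp 2 x‖ ^ q * (1 + ‖WithLp.toLp 2 x‖ ^ q) ^ (-(n : ℝ)) ∂μ := by
    rw [← integral_const_mul]
    refine integral_congr_ae ?_
    filter_upwards [hρae] with x hx
    rw [hx]
    ring
  rwa [e1, e2] at h

/-- The Sobolev inequality, with its constant expressed through integrals of the extremal. -/
theorem sobolev_inequality_of_integrable {n : ℕ} (hn : 2 ≤ n) {p q r : ℝ}
    (hpq : p.HolderConjugate q) (hr : 1 < r) (hrp : 1 / r = 1 / p - 1 / n)
    (h0 : Integrable fun x : EuclideanSpace ℝ (Fin n) => (1 + ‖x‖ ^ q) ^ (-(n : ℝ)))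
    (h1 : Integrable fun x : EuclideanSpace ℝ (Fin n) => ‖x‖ ^ q * (1 + ‖x‖ ^ q) ^ (-(n : ℝ)))
    (hs : Integrable fun x : EuclideanSpace ℝ (Fin n) => (1 + ‖x‖ ^ q) ^ (1 - (n : ℝ)))
    {u : EuclideanSpace ℝ (Fin n) → ℝ} (hu : ContDiff ℝ 1 u) (huc : HasCompactSupport u) :
    n * (((∫ x, |u x| ^ r) / ∫ x : EuclideanSpace ℝ (Fin n), (1 + ‖x‖ ^ q) ^ (-(n : ℝ))) ^ (1 / r) *
      ∫ x : EuclideanSpace ℝ (Fin n), (1 + ‖x‖ ^ q) ^ (1 - (n : ℝ))) ≤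
      (1 - 1 / (n : ℝ)) * r * ((∫ x, ‖fderiv ℝ u x‖ ^ p) ^ (1 / p) *
        (∫ x : EuclideanSpace ℝ (Fin n), ‖x‖ ^ q * (1 + ‖x‖ ^ q) ^ (-(n : ℝ))) ^ (1 / q)) := by
  have hn0 : (0 : ℝ) < n := by positivity
  have hn1 : (1 : ℝ) ≤ n := by exact_mod_cast (by omega : 1 ≤ n)
  have hp0 : 0 < p := hpq.pos
  have hq0 : 0 < q := hpq.symm.pos
  have hr0 : 0 < r := by linarith
  have hs0 : 0 ≤ 1 - 1 / (n : ℝ) := by rw [sub_nonneg, div_le_one hn0]; exact hn1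
  have hqr : 1 - 1 / (n : ℝ) = 1 / r + 1 / q := by
    rw [hrp, one_div q, one_div p, ← hpq.one_sub_inv]; ring
  have hBpos : ∀ (k : ℝ) (x : EuclideanSpace ℝ (Fin n)), 0 < (1 + ‖x‖ ^ q) ^ k :=
    fun k x => by positivity
  set U := ∫ x, |u x| ^ r with hU
  set I0 := ∫ x : EuclideanSpace ℝ (Fin n), (1 + ‖x‖ ^ q) ^ (-(n : ℝ)) with hI0
  set I1 := ∫ x : EuclideanSpace ℝ (Fin n), ‖x‖ ^ q * (1 + ‖x‖ ^ q) ^ (-(n : ℝ)) with hI1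
  have hU0 : 0 ≤ U := integral_nonneg fun x => by positivity
  have hI10 : 0 ≤ I1 := integral_nonneg fun x => by positivity
  rcases hU0.eq_or_lt with hU0 | hU0
  · rw [← hU0, zero_div, Real.zero_rpow (by positivity), zero_mul, mul_zero]
    have : 0 ≤ ∫ x, ‖fderiv ℝ u x‖ ^ p := integral_nonneg fun x => by positivity
    positivity
  obtain ⟨R, hR, huR⟩ : ∃ R : ℝ, 0 < R ∧ ∀ x, R ≤ ‖x‖ → u x = 0 := by
    obtain ⟨R, hR⟩ := huc.isCompact.isBounded.subset_ball 0
    refine ⟨max R 1, by positivity, fun x hx => ?_⟩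
    by_contra h
    have := hR (subset_tsupport u h)
    rw [mem_ball_zero_iff] at this
    exact absurd ((le_max_left R 1).trans hx) (not_le.2 this)
  have hfd : Integrable fun x => ‖fderiv ℝ u x‖ ^ p :=
    ((hu.continuous_fderiv one_ne_zero).norm.rpow_const fun _ => Or.inr hp0.le)
      |>.integrable_of_hasCompactSupport ((huc.fderiv ℝ).norm.comp_left
        (g := fun t : ℝ => t ^ p) (Real.zero_rpow hp0.ne'))
  refine le_of_tendsto (((tendsto_setIntegral_euclideanCube hs).const_mul _).const_mul _) ?_
  obtain ⟨N, hN⟩ := exists_nat_gt R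
  filter_upwards [Filter.eventually_ge_atTop N] with k hk
  have hk' : R ≤ k := hN.le.trans (by exact_mod_cast hk)
  have hk0 : (0 : ℝ) < k := hR.trans_le hk'
  set μ := cubeMeasure n (-k) k with hμ
  set Q := euclideanCube n (-k) k with hQ
  have hUk : U = ∫ x, |u (WithLp.toLp 2 x)| ^ r ∂μ := by
    rw [integral_cubeMeasure_comp_toLp (fun x => |u x| ^ r),
      setIntegral_eq_integral_of_forall_compl_eq_zero]
    intro x hx
    have hx' : R ≤ ‖x‖ := by
      by_contra h
      exact hx (exists_euclideanCube_subset ((not_le.1 h).trans_le hk'))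
    rw [huR x hx', abs_zero, Real.zero_rpow hr0.ne']
  have hV := cubeMeasure_real_univ_pos (n := n) hk0
  set J0 := ∫ x in Q, (1 + ‖x‖ ^ q) ^ (-(n : ℝ)) with hJ0
  set Js := ∫ x in Q, (1 + ‖x‖ ^ q) ^ (1 - (n : ℝ)) with hJs
  set J1 := ∫ x in Q, ‖x‖ ^ q * (1 + ‖x‖ ^ q) ^ (-(n : ℝ)) with hJ1
  set A := ∫ x in Q, ‖fderiv ℝ u x‖ ^ p with hA
  have hJ0I : J0 ≤ I0 := setIntegral_le_integral h0 (Filter.Eventually.of_forall fun x =>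
    (hBpos _ x).le)
  have hJ1I : J1 ≤ I1 := setIntegral_le_integral h1 (Filter.Eventually.of_forall fun x =>
    mul_nonneg (by positivity) (hBpos _ x).le)
  have hAI : A ≤ ∫ x, ‖fderiv ℝ u x‖ ^ p := setIntegral_le_integral hfd
    (Filter.Eventually.of_forall fun x => by positivity)
  have hA0 : 0 ≤ A := integral_nonneg fun x => by positivity
  have hJ10 : 0 ≤ J1 := integral_nonneg fun x => by positivity
  have hJs0 : 0 ≤ Js := integral_nonneg fun x => by positivity
  have hJ0pos : 0 < J0 := by
    rw [hJ0, integral_pos_iff_support_of_nonneg (fun x => (hBpos _ x).le) h0.integrableOn]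
    have : Function.support (fun x : EuclideanSpace ℝ (Fin n) => (1 + ‖x‖ ^ q) ^ (-(n : ℝ))) =
        univ := eq_univ_of_forall fun x => (hBpos _ x).ne'
    rw [this, Measure.restrict_apply_univ]
    refine (Metric.measure_ball_pos volume (0 : EuclideanSpace ℝ (Fin n)) hk0).trans_le
      (measure_mono fun x hx => exists_euclideanCube_subset (by simpa using hx))
  have key : n * ((U / J0) ^ (1 - 1 / (n : ℝ)) * Js) ≤
      (1 - 1 / (n : ℝ)) * r * (A ^ (1 / p) * (U / J0 * J1) ^ (1 / q)) := by
    have hle : ∀ ε ∈ Ioi (0 : ℝ), n * (((U + ε * μ.real univ) / J0) ^ (1 - 1 / (n : ℝ)) * Js) ≤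
        n * (ε ^ (1 - 1 / (n : ℝ)) * μ.real univ) + (1 - 1 / (n : ℝ)) * r *
          (A ^ (1 / p) * ((U + ε * μ.real univ) / J0 * J1) ^ (1 / q)) := by
      intro ε hε
      have h := card_mul_integral_truncated_le hn hpq hr hrp hu huc hk0
        (fun x hx => huR x (hk'.trans hx)) hε hUk
        (hJ0.trans (integral_cubeMeasure_comp_toLp fun x => (1 + ‖x‖ ^ q) ^ (-(n : ℝ))).symm) hJ0pos
      rwa [integral_cubeMeasure_comp_toLp fun x => (1 + ‖x‖ ^ q) ^ (1 - (n : ℝ)),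
        integral_cubeMeasure_comp_toLp fun x => ‖x‖ ^ q * (1 + ‖x‖ ^ q) ^ (-(n : ℝ)),
        integral_cubeMeasure_comp_toLp fun x => ‖fderiv ℝ u x‖ ^ p] at h
    have hc1 : Continuous fun ε : ℝ =>
        n * (((U + ε * μ.real univ) / J0) ^ (1 - 1 / (n : ℝ)) * Js) :=
      continuous_const.mul ((Continuous.rpow_const (by fun_prop) fun _ => Or.inr hs0).mul
        continuous_const)
    have hc2 : Continuous fun ε : ℝ => n * (ε ^ (1 - 1 / (n : ℝ)) * μ.real univ) +
        (1 - 1 / (n : ℝ)) * r *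
          (A ^ (1 / p) * ((U + ε * μ.real univ) / J0 * J1) ^ (1 / q)) :=
      (continuous_const.mul ((Continuous.rpow_const continuous_id fun _ => Or.inr hs0).mul
        continuous_const)).add (continuous_const.mul (continuous_const.mul
        (Continuous.rpow_const (by fun_prop) fun _ => Or.inr (by positivity))))
    have h := le_of_tendsto_of_tendsto (hc1.tendsto 0 |>.mono_left nhdsWithin_le_nhds)
      (hc2.tendsto 0 |>.mono_left nhdsWithin_le_nhds)
      (Filter.eventually_of_mem (self_mem_nhdsWithin (s := Ioi (0 : ℝ))) hle)
    have hs1 : 1 - 1 / (n : ℝ) ≠ 0 := by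
      rw [hqr]; positivity
    simpa only [zero_mul, add_zero, Real.zero_rpow hs1, mul_zero, zero_add] using h
  have hUJ : 0 < U / J0 := by positivity
  rw [hqr, Real.rpow_add hUJ, Real.mul_rpow hUJ.le hJ10, ← hqr] at key
  have key' : (U / J0) ^ (1 / q) * (n * ((U / J0) ^ (1 / r) * Js)) ≤
      (U / J0) ^ (1 / q) * ((1 - 1 / (n : ℝ)) * r * (A ^ (1 / p) * J1 ^ (1 / q))) := by
    linarith
  have key2 := le_of_mul_le_mul_left key' (by positivity)
  calc n * ((U / I0) ^ (1 / r) * Js) ≤ n * ((U / J0) ^ (1 / r) * Js) := by gcongr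
    _ ≤ _ := key2
    _ ≤ _ := by gcongr

theorem eulerBeta_pos {a b : ℝ} (ha : 0 < a) (hb : 0 < b) : 0 < eulerBeta a b :=
  ProbabilityTheory.beta_pos ha hb

theorem eulerBeta_comm (a b : ℝ) : eulerBeta a b = eulerBeta b a := by
  simp only [eulerBeta, mul_comm, add_comm]

theorem eulerBeta_add_one_left {a b : ℝ} (ha : 0 < a) (hb : 0 < b) :
    eulerBeta (a + 1) b * (a + b) = a * eulerBeta a b := by
  have h : 0 < Real.Gamma (a + b) := Real.Gamma_pos_of_pos (by positivity)
  rw [eulerBeta, eulerBeta, Real.Gamma_add_one ha.ne', add_right_comm,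
    Real.Gamma_add_one (by positivity)]
  field_simp

theorem integrableOn_beta {a b : ℝ} (ha : 0 < a) (hb : 0 < b) :
    IntegrableOn (fun x : ℝ => x ^ (a - 1) * (1 - x) ^ (b - 1)) (Ioo 0 1) ∧
      ∫ x in Ioo (0 : ℝ) 1, x ^ (a - 1) * (1 - x) ^ (b - 1) = eulerBeta a b := by
  have hc := Complex.betaIntegral_convergent (u := a) (v := b) (by simpa) (by simpa)
  rw [intervalIntegrable_iff_integrableOn_Ioo_of_le (by simp)] at hc
  have hre : ∀ x ∈ Ioo (0 : ℝ) 1,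
      RCLike.re ((x : ℂ) ^ ((a : ℂ) - 1) * (1 - (x : ℂ)) ^ ((b : ℂ) - 1)) =
        x ^ (a - 1) * (1 - x) ^ (b - 1) := fun x ⟨hx0, hx1⟩ => by
    norm_cast
    rw [← Complex.ofReal_cpow, ← Complex.ofReal_cpow, RCLike.re_to_complex,
      Complex.re_mul_ofReal, Complex.ofReal_re]
    all_goals linarith
  refine ⟨IntegrableOn.congr_fun (f := fun x : ℝ => RCLike.re
    ((x : ℂ) ^ ((a : ℂ) - 1) * (1 - (x : ℂ)) ^ ((b : ℂ) - 1))) hc.re hre measurableSet_Ioo, ?_⟩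
  rw [← setIntegral_congr_fun measurableSet_Ioo hre]
  change _ = ProbabilityTheory.beta a b
  rw [ProbabilityTheory.beta_eq_betaIntegralReal a b ha hb, Complex.betaIntegral,
    intervalIntegral.integral_of_le (by norm_num), integral_Ioc_eq_integral_Ioo,
    ← RCLike.re_to_complex, ← integral_re hc]

theorem integrableOn_Ioi_beta {a b : ℝ} (ha : 0 < a) (hb : 0 < b) :
    IntegrableOn (fun t : ℝ => t ^ (a - 1) * (1 + t) ^ (-(a + b))) (Ioi 0) ∧
      ∫ t in Ioi (0 : ℝ), t ^ (a - 1) * (1 + t) ^ (-(a + b)) = eulerBeta a b := by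
  have himg : (fun x : ℝ => x / (1 - x)) '' Ioo 0 1 = Ioi 0 := by
    ext t
    constructor
    · rintro ⟨x, ⟨hx0, hx1⟩, rfl⟩
      exact div_pos hx0 (by linarith)
    · intro (ht : 0 < t)
      refine ⟨t / (1 + t), ⟨by positivity, (div_lt_one (by positivity)).2 (by linarith)⟩, ?_⟩
      simp only
      field_simp
      simp
  have hder : ∀ x ∈ Ioo (0 : ℝ) 1, HasDerivWithinAt (fun x : ℝ => x / (1 - x))
      (1 / (1 - x) ^ 2) (Ioo 0 1) x := fun x ⟨_, hx1⟩ => by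
    have h1 : 1 - x ≠ 0 := by linarith
    have := (hasDerivAt_id x).div ((hasDerivAt_const x (1 : ℝ)).sub (hasDerivAt_id x)) h1
    convert! this.hasDerivWithinAt using 1
    simp
  have hinj : InjOn (fun x : ℝ => x / (1 - x)) (Ioo 0 1) := fun x ⟨_, hx⟩ y ⟨_, hy⟩ h => by
    have h1 : 1 - x ≠ 0 := by linarith
    have h2 : 1 - y ≠ 0 := by linarith
    simp only at h
    field_simp at h
    linarith
  have hval : ∀ x ∈ Ioo (0 : ℝ) 1, |1 / (1 - x) ^ 2| •
      ((x / (1 - x)) ^ (a - 1) * (1 + x / (1 - x)) ^ (-(a + b))) =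
        x ^ (a - 1) * (1 - x) ^ (b - 1) := fun x ⟨hx0, hx1⟩ => by
    have h1 : 0 < 1 - x := by linarith
    have h2 : 1 + x / (1 - x) = (1 - x)⁻¹ := by field_simp; ring
    rw [abs_of_pos (by positivity), h2, Real.div_rpow hx0.le h1.le, Real.inv_rpow h1.le,
      ← Real.rpow_neg h1.le, smul_eq_mul, ← Real.rpow_natCast, one_div, ← Real.rpow_neg h1.le,
      div_eq_mul_inv, ← Real.rpow_neg h1.le, mul_left_comm, mul_assoc,
      ← Real.rpow_add h1, ← Real.rpow_add h1]
    congr 2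
    push_cast
    ring
  rw [← himg, integrableOn_image_iff_integrableOn_abs_deriv_smul measurableSet_Ioo hder hinj,
    integral_image_eq_integral_abs_deriv_smul measurableSet_Ioo hder hinj,
    integrableOn_congr_fun hval measurableSet_Ioo, setIntegral_congr_fun measurableSet_Ioo hval]
  exact integrableOn_beta ha hb

theorem integrableOn_Ioi_rpow_mul_one_add_rpow {q m k : ℝ} (hq : 0 < q) (hm : 0 < m)
    (hk : m < q * k) :
    IntegrableOn (fun y : ℝ => y ^ (m - 1) * (1 + y ^ q) ^ (-k)) (Ioi 0) ∧
      ∫ y in Ioi (0 : ℝ), y ^ (m - 1) * (1 + y ^ q) ^ (-k) =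
        q⁻¹ * eulerBeta (m / q) (k - m / q) := by
  have hb : 0 < k - m / q := by rw [sub_pos, div_lt_iff₀ hq]; linarith
  have h := integrableOn_Ioi_beta (div_pos hm hq) hb
  rw [add_sub_cancel] at h
  have hval : ∀ y ∈ Ioi (0 : ℝ), y ^ (q - 1) • ((y ^ q) ^ (m / q - 1) * (1 + y ^ q) ^ (-k)) =
      y ^ (m - 1) * (1 + y ^ q) ^ (-k) := fun y (hy : 0 < y) => by
    rw [← Real.rpow_mul hy.le, smul_eq_mul, ← mul_assoc, ← Real.rpow_add hy]
    congr 2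
    field_simp
    ring
  have hval' : ∀ y ∈ Ioi (0 : ℝ), (q * y ^ (q - 1)) •
      ((y ^ q) ^ (m / q - 1) * (1 + y ^ q) ^ (-k)) =
      q * (y ^ (m - 1) * (1 + y ^ q) ^ (-k)) := fun y hy => by
    rw [← hval y hy]; simp only [smul_eq_mul]; ring
  refine ⟨(integrableOn_congr_fun hval measurableSet_Ioi).1
    ((integrableOn_Ioi_comp_rpow_iff' _ hq.ne').2 h.1), ?_⟩
  rw [← h.2, ← integral_comp_rpow_Ioi_of_pos
    (g := fun t : ℝ => t ^ (m / q - 1) * (1 + t) ^ (-k)) hq,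
    setIntegral_congr_fun measurableSet_Ioi hval',
    integral_const_mul, inv_mul_cancel_left₀ hq.ne']

theorem card_mul_volume_ball {n : ℕ} (hn : 0 < n) :
    n * (volume : Measure (EuclideanSpace ℝ (Fin n))).real (Metric.ball 0 1) =
      2 * π ^ ((n : ℝ) / 2) / Real.Gamma ((n : ℝ) / 2) := by
  have : Nonempty (Fin n) := ⟨⟨0, hn⟩⟩
  have hn' : (0 : ℝ) < n := by exact_mod_cast hn
  have hG : 0 < Real.Gamma ((n : ℝ) / 2) := Real.Gamma_pos_of_pos (by positivity)
  have hG1 : 0 < Real.Gamma ((n : ℝ) / 2 + 1) := Real.Gamma_pos_of_pos (by positivity)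
  rw [Measure.real, EuclideanSpace.volume_ball, Fintype.card_fin, ENNReal.ofReal_one, one_pow,
    one_mul, ENNReal.toReal_ofReal (by positivity), Real.Gamma_add_one (by positivity),
    Real.sqrt_eq_rpow, ← Real.rpow_mul_natCast pi_pos.le]
  rw [one_div_mul_eq_div]
  field_simp

theorem integral_norm_rpow_mul_one_add {n : ℕ} (hn : 0 < n) {q α k : ℝ} (hq : 0 < q)
    (hα : 0 ≤ α) (hk : n + α < q * k) :
    Integrable (fun x : EuclideanSpace ℝ (Fin n) => ‖x‖ ^ α * (1 + ‖x‖ ^ q) ^ (-k)) ∧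
      ∫ x : EuclideanSpace ℝ (Fin n), ‖x‖ ^ α * (1 + ‖x‖ ^ q) ^ (-k) =
        2 * π ^ ((n : ℝ) / 2) / Real.Gamma ((n : ℝ) / 2) *
          (q⁻¹ * eulerBeta ((n + α) / q) (k - (n + α) / q)) := by
  have : NeZero n := ⟨hn.ne'⟩
  have : Nonempty (Fin n) := ⟨⟨0, hn⟩⟩
  have hn' : (0 : ℝ) < n := by exact_mod_cast hn
  have h := integrableOn_Ioi_rpow_mul_one_add_rpow hq (by positivity : 0 < n + α) hk
  have hval : ∀ y ∈ Ioi (0 : ℝ), y ^ (n - 1) • (y ^ α * (1 + y ^ q) ^ (-k)) =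
      y ^ (n + α - 1) * (1 + y ^ q) ^ (-k) := fun y (hy : 0 < y) => by
    rw [smul_eq_mul, ← mul_assoc, ← Real.rpow_natCast, ← Real.rpow_add hy,
      Nat.cast_sub hn, Nat.cast_one]
    congr 2
    ring
  rw [integrable_fun_norm_addHaar volume (f := fun y : ℝ => y ^ α * (1 + y ^ q) ^ (-k)),
    integral_fun_norm_addHaar volume (fun y : ℝ => y ^ α * (1 + y ^ q) ^ (-k)),
    finrank_euclideanSpace_fin, integrableOn_congr_fun hval measurableSet_Ioi,
    setIntegral_congr_fun measurableSet_Ioi hval, h.2, ← card_mul_volume_ball hn, nsmul_eq_mul,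
    smul_eq_mul, mul_assoc]
  exact ⟨h.1, rfl⟩

theorem integrals_one_add_norm_rpow {n : ℕ} (hn : 2 ≤ n) {p q : ℝ} (hpq : p.HolderConjugate q)
    (hpn : p < n) :
    (Integrable fun x : EuclideanSpace ℝ (Fin n) => (1 + ‖x‖ ^ q) ^ (-(n : ℝ))) ∧
    (Integrable fun x : EuclideanSpace ℝ (Fin n) => ‖x‖ ^ q * (1 + ‖x‖ ^ q) ^ (-(n : ℝ))) ∧
    (Integrable fun x : EuclideanSpace ℝ (Fin n) => (1 + ‖x‖ ^ q) ^ (1 - (n : ℝ))) ∧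
    0 < (∫ x : EuclideanSpace ℝ (Fin n), (1 + ‖x‖ ^ q) ^ (-(n : ℝ))) ∧
    (∫ x : EuclideanSpace ℝ (Fin n), (1 + ‖x‖ ^ q) ^ (-(n : ℝ))) =
      2 * π ^ ((n : ℝ) / 2) / Real.Gamma ((n : ℝ) / 2) * eulerBeta (n / p) (n / q + 1) ∧
    (∫ x : EuclideanSpace ℝ (Fin n), ‖x‖ ^ q * (1 + ‖x‖ ^ q) ^ (-(n : ℝ))) =
      n * ((p - 1) / (n - p)) * ∫ x : EuclideanSpace ℝ (Fin n), (1 + ‖x‖ ^ q) ^ (-(n : ℝ)) ∧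
    n * (∫ x : EuclideanSpace ℝ (Fin n), (1 + ‖x‖ ^ q) ^ (1 - (n : ℝ))) =
      (n - 1) * q * ∫ x : EuclideanSpace ℝ (Fin n), ‖x‖ ^ q * (1 + ‖x‖ ^ q) ^ (-(n : ℝ)) := by
  have hn0 : 0 < n := by omega
  have hn' : (2 : ℝ) ≤ n := by exact_mod_cast hn
  have hp := hpq.pos
  have hp1 := hpq.lt
  have hq := hpq.symm.pos
  have hq1 := hpq.symm.lt
  have hmul := hpq.mul_eq_add
  have hG : 0 < 2 * π ^ ((n : ℝ) / 2) / Real.Gamma ((n : ℝ) / 2) := by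
    have : 0 < Real.Gamma ((n : ℝ) / 2) := Real.Gamma_pos_of_pos (by positivity)
    have := pi_pos
    positivity
  have h0 := integral_norm_rpow_mul_one_add (α := 0) (k := n) hn0 hq le_rfl (by nlinarith)
  have h1 := integral_norm_rpow_mul_one_add (α := q) (k := n) hn0 hq hq.le (by nlinarith)
  have h2 := integral_norm_rpow_mul_one_add (α := 0) (k := n - 1) hn0 hq le_rfl (by nlinarith)
  simp only [Real.rpow_zero, one_mul, add_zero, neg_sub] at h0 h1 h2
  have ha : 0 < (n : ℝ) / q := by positivity
  have hb : 0 < (n : ℝ) / p - 1 := by rw [sub_pos, lt_div_iff₀ hp]; linarith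
  have hab : (n : ℝ) / q + n / p = n := by
    field_simp
    linarith
  have e1 : ((n : ℝ) + q) / q = n / q + 1 := by field_simp
  have e2 : (n : ℝ) - (n / q + 1) = n / p - 1 := by linarith
  have e3 : (n : ℝ) - n / q = n / p := by linarith
  have e4 : (n : ℝ) - 1 - n / q = n / p - 1 := by linarith
  rw [e1, e2] at h1
  rw [e3] at h0
  rw [e4] at h2
  have b1 := eulerBeta_add_one_left ha hb
  have b2 := eulerBeta_add_one_left hb ha
  have b3 := eulerBeta_add_one_left ha (by linarith : 0 < (n : ℝ) / p)
  rw [sub_add_cancel, eulerBeta_comm _ ((n : ℝ) / q), eulerBeta_comm _ ((n : ℝ) / q)] at b2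
  rw [hab] at b3
  rw [show (n : ℝ) / q + (n / p - 1) = n - 1 by linarith] at b1
  rw [show (n : ℝ) / p - 1 + n / q = n - 1 by linarith] at b2
  have hpos := eulerBeta_pos ha (by linarith : 0 < (n : ℝ) / p)
  rw [h0.2, h1.2, h2.2, eulerBeta_comm (n / p)]
  have hqp : (n : ℝ) / q = n * (p - 1) / p := by
    field_simp
    linarith
  refine ⟨h0.1, h1.1, h2.1, by positivity, ?_, ?_, ?_⟩
  · congr 1
    field_simp at b3 ⊢
    linarith
  · have hnp : 0 < n - p := by linarith
    have key : eulerBeta (n / q + 1) (n / p - 1) =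
        n * ((p - 1) / (n - p)) * eulerBeta (n / q) (n / p) := by
      have hn1 : (0 : ℝ) < n - 1 := by linarith
      have hc : (n : ℝ) / q = n * ((p - 1) / (n - p)) * (n / p - 1) := by
        rw [hqp]; field_simp
      refine mul_right_cancel₀ hn1.ne' ?_
      rw [b1, mul_assoc _ (eulerBeta _ _), b2, ← mul_assoc, ← hc]
    rw [key]
    ring
  · have key : n * eulerBeta (n / q) (n / p - 1) =
        (n - 1) * q * eulerBeta (n / q + 1) (n / p - 1) := by
      rw [mul_comm _ q, mul_assoc, mul_comm ((n : ℝ) - 1), b1]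
      field_simp
    linear_combination (2 * π ^ ((n : ℝ) / 2) / Real.Gamma ((n : ℝ) / 2) * q⁻¹) * key

theorem sobolevC_eq {n : ℕ} (hn : 2 ≤ n) {p q r : ℝ} (hpq : p.HolderConjugate q) (hpn : p < n)
    (hrp : 1 / r = 1 / p - 1 / n) :
    sobolevC n p = (p - 1) / (n - p) *
      (∫ x : EuclideanSpace ℝ (Fin n), ‖x‖ ^ q * (1 + ‖x‖ ^ q) ^ (-(n : ℝ))) ^ (-(1 / p)) *
      (∫ x : EuclideanSpace ℝ (Fin n), (1 + ‖x‖ ^ q) ^ (-(n : ℝ))) ^ (1 / r) := by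
  obtain ⟨-, -, -, hI0, hI, hI1, -⟩ := integrals_one_add_norm_rpow hn hpq hpn
  have hn0 : (0 : ℝ) < n := by positivity
  have hl : 0 < (p - 1) / ((n : ℝ) - p) := div_pos (by linarith [hpq.lt]) (by linarith)
  have hG : 0 < 2 * π ^ ((n : ℝ) / 2) / Real.Gamma ((n : ℝ) / 2) := by
    have : 0 < Real.Gamma ((n : ℝ) / 2) := Real.Gamma_pos_of_pos (by positivity)
    have := pi_pos
    positivity
  have hB : 0 < eulerBeta ((n : ℝ) / p) (n / q + 1) := by
    have := hpq.pos
    have := hpq.symm.pos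
    exact eulerBeta_pos (by positivity) (by positivity)
  rw [hI1]
  set I := ∫ x : EuclideanSpace ℝ (Fin n), (1 + ‖x‖ ^ q) ^ (-(n : ℝ))
  rw [sobolevC, ← hpq.conjugate_eq, Real.mul_rpow (by positivity) hI0.le,
    Real.mul_rpow hn0.le hl.le]
  have e1 : I ^ (1 / r) = I ^ (1 / p) * I ^ (-(1 / (n : ℝ))) := by
    rw [hrp, sub_eq_add_neg, Real.rpow_add hI0]
  have e2 : ((p - 1) / ((n : ℝ) - p)) ^ (1 / q) =
      (p - 1) / (n - p) * ((p - 1) / ((n : ℝ) - p)) ^ (-(1 / p)) := by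
    rw [show 1 / q = 1 + -(1 / p) by
      have := hpq.inv_add_inv_eq_one
      simp only [one_div]; linarith, Real.rpow_add hl, Real.rpow_one]
  have e3 : I ^ (-(1 / p)) * I ^ (1 / p) = 1 := by
    rw [← Real.rpow_add hI0, neg_add_cancel, Real.rpow_zero]
  have e4 : I ^ (-(1 / (n : ℝ))) =
      (2 * π ^ ((n : ℝ) / 2) / Real.Gamma ((n : ℝ) / 2)) ^ (-(1 / (n : ℝ))) *
        (eulerBeta ((n : ℝ) / p) (n / q + 1)) ^ (-(1 / (n : ℝ))) := by
    rw [hI, Real.mul_rpow hG.le hB.le]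
  rw [e1, e2, e4]
  linear_combination (- (n : ℝ) ^ (-(1 / p)) * ((p - 1) / (n - p) *
    ((p - 1) / ((n : ℝ) - p)) ^ (-(1 / p)))) *
    (2 * π ^ ((n : ℝ) / 2) / Real.Gamma ((n : ℝ) / 2)) ^ (-(1 / (n : ℝ))) *
    (eulerBeta ((n : ℝ) / p) (n / q + 1)) ^ (-(1 / (n : ℝ))) * e3

theorem sobolev_inequality {n : ℕ} (hn : 2 ≤ n) {p q r : ℝ}
    (hpq : p.HolderConjugate q) (hpn : p < n) (hr : 1 < r) (hrp : 1 / r = 1 / p - 1 / n)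
    {u : EuclideanSpace ℝ (Fin n) → ℝ} (hu : ContDiff ℝ 1 u) (huc : HasCompactSupport u) :
    (∫ x, |u x| ^ r) ^ (1 / r) ≤ sobolevC n p * (∫ x, ‖fderiv ℝ u x‖ ^ p) ^ (1 / p) := by
  obtain ⟨h0, h1, hs, hI0, -, hI1, hIs⟩ := integrals_one_add_norm_rpow hn hpq hpn
  have h := sobolev_inequality_of_integrable hn hpq hr hrp h0 h1 hs hu huc
  rw [sobolevC_eq hn hpq hpn hrp]
  have hn0 : (2 : ℝ) ≤ n := by exact_mod_cast hn
  have hl : 0 < (p - 1) / ((n : ℝ) - p) := div_pos (by linarith [hpq.lt]) (by linarith)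
  have hpos1 : 0 < ∫ x : EuclideanSpace ℝ (Fin n), ‖x‖ ^ q * (1 + ‖x‖ ^ q) ^ (-(n : ℝ)) := by
    rw [hI1]; positivity
  set I0 := ∫ x : EuclideanSpace ℝ (Fin n), (1 + ‖x‖ ^ q) ^ (-(n : ℝ))
  set I1 := ∫ x : EuclideanSpace ℝ (Fin n), ‖x‖ ^ q * (1 + ‖x‖ ^ q) ^ (-(n : ℝ))
  set Is := ∫ x : EuclideanSpace ℝ (Fin n), (1 + ‖x‖ ^ q) ^ (1 - (n : ℝ))
  have hA : 0 ≤ ∫ x, |u x| ^ r := integral_nonneg fun x => by positivity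
  set A := ∫ x, |u x| ^ r
  set G := ∫ x, ‖fderiv ℝ u x‖ ^ p
  have hp := hpq.pos
  have hq := hpq.symm.pos
  have hr0 : 0 < r := by linarith
  rw [Real.div_rpow hA hI0.le] at h
  have hI0r : 0 < I0 ^ (1 / r) := by positivity
  have hlr : r = n * q * ((p - 1) / (n - p)) := by
    have hpnr : (n - p) * r = n * p := by
      field_simp at hrp
      linarith
    have := hpq.sub_one_mul_conj
    have : (n : ℝ) - p ≠ 0 := by linarith
    field_simp
    linear_combination hpnr - n * hpq.sub_one_mul_conj
  have e : I1 ^ (1 / q) = I1 * I1 ^ (-(1 / p)) := by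
    rw [show 1 / q = 1 + -(1 / p) by
      have := hpq.inv_add_inv_eq_one
      simp only [one_div]; linarith, Real.rpow_add hpos1, Real.rpow_one]
  have hc : 0 < ((n : ℝ) - 1) * q * I1 := by
    have : (0 : ℝ) < n - 1 := by linarith
    positivity
  have h' : A ^ (1 / r) / I0 ^ (1 / r) * ((n - 1) * q * I1) ≤
      ((p - 1) / (n - p) * I1 ^ (-(1 / p)) * G ^ (1 / p)) * ((n - 1) * q * I1) := by
    calc _ = n * (A ^ (1 / r) / I0 ^ (1 / r) * Is) := by rw [← hIs]; ring
      _ ≤ _ := h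
      _ = _ := by
        rw [e, hlr]
        field_simp
  have := le_of_mul_le_mul_right h' hc
  rw [div_le_iff₀ hI0r] at this
  linarith

theorem exists_cutoff (n : ℕ) : ∃ M : ℝ, 0 ≤ M ∧ ∀ R : ℝ, 1 ≤ R →
    ∃ χ : EuclideanSpace ℝ (Fin n) → ℝ, ContDiff ℝ (⊤ : ℕ∞) χ ∧ HasCompactSupport χ ∧
      (∀ x, χ x ∈ Icc 0 1) ∧ (∀ x, ‖x‖ ≤ R → χ x = 1) ∧
      ∀ x, ‖fderiv ℝ χ x‖ ≤ min (M / R) (3 * M / (1 + ‖x‖)) := by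
  let b : ContDiffBump (0 : EuclideanSpace ℝ (Fin n)) := ⟨1, 2, one_pos, one_lt_two⟩
  have hb : ContDiff ℝ (⊤ : ℕ∞) b := b.contDiff
  obtain ⟨M, hM⟩ := (hb.continuous_fderiv (by simp)).bounded_above_of_compact_support
    (b.hasCompactSupport.fderiv ℝ)
  have hM0 : 0 ≤ M := (norm_nonneg _).trans (hM 0)
  refine ⟨M, hM0, fun R hR => ?_⟩
  have hR0 : 0 < R := by linarith
  have hnorm : ∀ x : EuclideanSpace ℝ (Fin n), ‖R⁻¹ • x‖ = ‖x‖ / R := fun x => by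
    rw [norm_smul, norm_inv, Real.norm_of_nonneg hR0.le, inv_mul_eq_div]
  refine ⟨fun x => b (R⁻¹ • x), hb.comp (contDiff_const_smul _),
    b.hasCompactSupport.comp_smul (inv_ne_zero hR0.ne'), fun x => ⟨b.nonneg, b.le_one⟩,
    fun x hx => b.one_of_mem_closedBall ?_, fun x => ?_⟩
  · rw [mem_closedBall_zero_iff, hnorm]
    exact (div_le_one hR0).2 hx
  · rw [fderiv_comp_smul, norm_smul, norm_inv, Real.norm_of_nonneg hR0.le, inv_mul_eq_div]
    refine le_min (by gcongr; exact hM _) ?_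
    by_cases hx : R⁻¹ • x ∈ tsupport b
    · rw [b.tsupport_eq, mem_closedBall_zero_iff, hnorm, div_le_iff₀ hR0] at hx
      change ‖x‖ ≤ 2 * R at hx
      rw [div_le_div_iff₀ hR0 (by positivity)]
      calc _ ≤ M * (1 + ‖x‖) := by gcongr; exact hM _
        _ ≤ M * (3 * R) := by gcongr; linarith
        _ = _ := by ring
    · have : fderiv ℝ b (R⁻¹ • x) = 0 := by
        by_contra h
        exact hx (support_fderiv_subset ℝ (Function.mem_support.2 h))
      rw [this, norm_zero, zero_div]
      positivity

theorem contDiff_one_add_sqrt_rpow {n : ℕ} {q γ δ : ℝ} (hq : 1 < q) (hγ : 0 < γ) (hδ : 0 < δ) :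
    ContDiff ℝ (⊤ : ℕ∞)
      (fun x : EuclideanSpace ℝ (Fin n) => (1 + √(‖x‖ ^ 2 + δ) ^ q) ^ (-γ)) ∧
    ∀ x : EuclideanSpace ℝ (Fin n),
      ‖fderiv ℝ (fun x : EuclideanSpace ℝ (Fin n) => (1 + √(‖x‖ ^ 2 + δ) ^ q) ^ (-γ)) x‖ ≤
        γ * q * ((1 + √(‖x‖ ^ 2 + δ) ^ q) ^ (-(γ + 1)) * √(‖x‖ ^ 2 + δ) ^ (q - 1)) := by
  have hpos : ∀ x : EuclideanSpace ℝ (Fin n), 0 < ‖x‖ ^ 2 + δ := fun x => by positivity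
  constructor
  · refine ContDiff.rpow_const_of_ne (contDiff_const.add (ContDiff.rpow_const_of_ne
      (ContDiff.sqrt ((contDiff_norm_sq ℝ).add contDiff_const) fun x => (hpos x).ne') fun x =>
        (Real.sqrt_pos.2 (hpos x)).ne')) fun x => ?_
    positivity
  · intro x
    have hρ := Real.sqrt_pos.2 (hpos x)
    have h1 : HasFDerivAt (fun x : EuclideanSpace ℝ (Fin n) => √(‖x‖ ^ 2 + δ)) _ x :=
      ((hasFDerivAt_id x).norm_sq.add_const δ).sqrt (hpos x).ne'
    set ρ := √(‖x‖ ^ 2 + δ) with hρdef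
    have h2 : HasDerivAt (fun s : ℝ => (1 + s ^ q) ^ (-γ))
        ((q * ρ ^ (q - 1)) * (-γ) * (1 + ρ ^ q) ^ (-γ - 1)) ρ :=
      ((Real.hasDerivAt_rpow_const (Or.inl hρ.ne')).const_add 1).rpow_const
        (Or.inl (by positivity))
    have h3 := h2.comp_hasFDerivAt x h1
    have h4 : fderiv ℝ (fun x : EuclideanSpace ℝ (Fin n) => (1 + √(‖x‖ ^ 2 + δ) ^ q) ^ (-γ)) x =
        _ := h3.fderiv
    have h5 : ‖(1 / (2 * ρ)) • (2 • (innerSL ℝ) (id x) ∘SL ContinuousLinearMap.id ℝ _)‖ ≤ 1 := by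
      rw [norm_smul, ContinuousLinearMap.comp_id, ← Nat.cast_smul_eq_nsmul ℝ, norm_smul,
        innerSL_apply_norm]
      simp only [id, Nat.cast_ofNat, Real.norm_ofNat]
      rw [Real.norm_of_nonneg (by positivity), one_div_mul_eq_div, mul_div_mul_left _ _ two_ne_zero,
        div_le_one hρ]
      exact Real.le_sqrt_of_sq_le (by linarith)
    rw [h4, norm_smul]
    refine (mul_le_of_le_one_right (norm_nonneg _) h5).trans_eq ?_
    rw [norm_mul, norm_mul, norm_neg, Real.norm_of_nonneg (by positivity),
      Real.norm_of_nonneg hγ.le, Real.norm_of_nonneg (by positivity), neg_add']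
    ring

theorem one_add_rpow_neg_mul_le {n p q s ρ c l M : ℝ} (hpq : p.HolderConjugate q) (hpn : p < n)
    (hs : 0 ≤ s) (hsρ : s ≤ ρ) (hl : 0 ≤ l) (hM : 0 ≤ M) (hc0 : 0 ≤ c)
    (hc : c ≤ 3 * M / (1 + s)) :
    l * ((1 + ρ ^ q) ^ (-(n / p)) * ρ ^ (q - 1)) + (1 + ρ ^ q) ^ (-((n - p) / p)) * c ≤
      (l + 3 * M) * (1 + s ^ q) ^ ((1 - n) / p) := by
  have hp := hpq.pos
  have hp1 := hpq.lt
  have hq := hpq.symm.pos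
  have hρ : 0 ≤ ρ := hs.trans hsρ
  have hsq : 0 ≤ s ^ q := Real.rpow_nonneg hs q
  have hρq : 0 ≤ ρ ^ q := Real.rpow_nonneg hρ q
  have hle : s ^ q ≤ ρ ^ q := Real.rpow_le_rpow hs hsρ hq.le
  have hinv : 1 / p + 1 / q = 1 := by simpa only [one_div] using hpq.inv_add_inv_eq_one
  rw [add_mul]
  refine add_le_add (mul_le_mul_of_nonneg_left ?_ hl) ?_
  · have e : ρ ^ (q - 1) = (ρ ^ q) ^ (1 / p) := by
      rw [← Real.rpow_mul hρ]
      congr 1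
      have := hpq.mul_eq_add
      field_simp
      linarith
    calc _ ≤ (1 + ρ ^ q) ^ (-(n / p)) * (1 + ρ ^ q) ^ (1 / p) := by
          rw [e]
          gcongr
          linarith
      _ = (1 + ρ ^ q) ^ ((1 - n) / p) := by
          rw [← Real.rpow_add (by positivity)]
          congr 1
          ring
      _ ≤ _ := Real.rpow_le_rpow_of_nonpos (by positivity) (by linarith)
          (div_nonpos_of_nonpos_of_nonneg (by linarith) hp.le)
  · have h1 : (1 + s)⁻¹ ≤ (1 + s ^ q) ^ (-(1 / q)) := by
      rw [Real.rpow_neg (by positivity)]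
      gcongr
      have h := Real.add_rpow_le_rpow_add zero_le_one hs hpq.symm.lt.le
      rw [Real.one_rpow] at h
      calc (1 + s ^ q) ^ (1 / q) ≤ ((1 + s) ^ q) ^ (1 / q) := by gcongr
        _ = 1 + s := by
          rw [← Real.rpow_mul (by positivity), mul_one_div_cancel hq.ne', Real.rpow_one]
    calc _ ≤ (1 + s ^ q) ^ (-((n - p) / p)) * (3 * M * (1 + s ^ q) ^ (-(1 / q))) := by
          refine mul_le_mul ?_ (hc.trans ?_) hc0 (by positivity)
          · exact Real.rpow_le_rpow_of_nonpos (by positivity) (by linarith)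
              (neg_nonpos.2 (div_nonneg (by linarith) hp.le))
          · rw [div_eq_mul_inv]
            gcongr
      _ = 3 * M * ((1 + s ^ q) ^ (-((n - p) / p)) * (1 + s ^ q) ^ (-(1 / q))) := by ring
      _ = _ := by
          rw [← Real.rpow_add (by positivity)]
          congr 2
          rw [show -(1 / q) = 1 / p - 1 by linarith]
          field_simp
          ring

theorem tendsto_sqrt_sq_add_inv {s : ℝ} (hs : 0 ≤ s) :
    Filter.Tendsto (fun k : ℕ => √(s ^ 2 + 1 / ((k : ℝ) + 1))) Filter.atTop (nhds s) := by
  have h := (Real.continuous_sqrt.tendsto _).comp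
    ((tendsto_one_div_add_atTop_nhds_zero_nat (𝕜 := ℝ)).const_add (s ^ 2))
  rwa [add_zero, Real.sqrt_sq hs] at h

theorem tendsto_integral_gradient_bound {n : ℕ} (hn : 2 ≤ n) {p q l M : ℝ}
    (hpq : p.HolderConjugate q) (hpn : p < n) (hl : 0 ≤ l) (hM : 0 ≤ M) :
    let G : ℕ → EuclideanSpace ℝ (Fin n) → ℝ := fun k x =>
      l * ((1 + √(‖x‖ ^ 2 + 1 / ((k : ℝ) + 1)) ^ q) ^ (-((n : ℝ) / p)) *
        √(‖x‖ ^ 2 + 1 / ((k : ℝ) + 1)) ^ (q - 1)) +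
      (1 + √(‖x‖ ^ 2 + 1 / ((k : ℝ) + 1)) ^ q) ^ (-((n - p) / p)) *
        min (M / ((k : ℝ) + 1)) (3 * M / (1 + ‖x‖))
    (∀ k, Integrable fun x => G k x ^ p) ∧
    Filter.Tendsto (fun k => ∫ x, G k x ^ p) Filter.atTop
      (nhds (l ^ p * ∫ x : EuclideanSpace ℝ (Fin n), ‖x‖ ^ q * (1 + ‖x‖ ^ q) ^ (-(n : ℝ)))) := by
  intro G
  obtain ⟨-, -, hs, -⟩ := integrals_one_add_norm_rpow hn hpq hpn
  have hp := hpq.pos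
  have hq1 : 0 < q - 1 := by linarith [hpq.symm.lt]
  have hq : 0 < q := by linarith
  have hle : ∀ (k : ℕ) (x : EuclideanSpace ℝ (Fin n)), ‖x‖ ≤ √(‖x‖ ^ 2 + 1 / ((k : ℝ) + 1)) :=
    fun k x => Real.le_sqrt_of_sq_le (by linarith [show 0 ≤ 1 / ((k : ℝ) + 1) by positivity])
  have hG0 : ∀ k x, 0 ≤ G k x := fun k x => by
    have : 0 ≤ min (M / ((k : ℝ) + 1)) (3 * M / (1 + ‖x‖)) := le_min (by positivity) (by positivity)
    positivity
  have hbound : ∀ k x, ‖G k x ^ p‖ ≤ (l + 3 * M) ^ p * (1 + ‖x‖ ^ q) ^ (1 - (n : ℝ)) :=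
    fun k x => by
    rw [Real.norm_of_nonneg (Real.rpow_nonneg (hG0 k x) p)]
    refine (Real.rpow_le_rpow (hG0 k x) (one_add_rpow_neg_mul_le hpq hpn (norm_nonneg x) (hle k x)
      hl hM (le_min (by positivity) (by positivity)) (min_le_right _ _)) hp.le).trans_eq ?_
    rw [Real.mul_rpow (by positivity) (by positivity), ← Real.rpow_mul (by positivity),
      div_mul_cancel₀ _ hp.ne']
  have hmeas : ∀ k, AEStronglyMeasurable (fun x => G k x ^ p) volume := fun k => by
    refine Measurable.aestronglyMeasurable ?_
    simp only [G]
    fun_prop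
  have hint := hs.const_mul ((l + 3 * M) ^ p)
  refine ⟨fun k => hint.mono' (hmeas k) (Filter.Eventually.of_forall (hbound k)), ?_⟩
  rw [← integral_const_mul]
  refine tendsto_integral_of_dominated_convergence _ hmeas hint
    (fun k => Filter.Eventually.of_forall (hbound k)) (Filter.Eventually.of_forall fun x => ?_)
  have hρ := tendsto_sqrt_sq_add_inv (norm_nonneg x)
  have hxq : 0 ≤ ‖x‖ ^ q := by positivity
  have hone : Filter.Tendsto (fun k : ℕ => 1 + √(‖x‖ ^ 2 + 1 / ((k : ℝ) + 1)) ^ q) Filter.atTop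
      (nhds (1 + ‖x‖ ^ q)) := (hρ.rpow_const (Or.inr hq.le)).const_add 1
  have hmin : Filter.Tendsto (fun k : ℕ => min (M / ((k : ℝ) + 1)) (3 * M / (1 + ‖x‖)))
      Filter.atTop (nhds 0) := by
    have h0 : Filter.Tendsto (fun k : ℕ => M / ((k : ℝ) + 1)) Filter.atTop (nhds 0) := by
      simpa [div_eq_mul_inv] using
        (tendsto_one_div_add_atTop_nhds_zero_nat (𝕜 := ℝ)).const_mul M
    exact squeeze_zero (fun k => le_min (by positivity) (by positivity))
      (fun k => min_le_left _ _) h0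
  have h := ((((hone.rpow_const (p := -((n : ℝ) / p)) (Or.inl (by positivity))).mul
    (hρ.rpow_const (p := q - 1) (Or.inr hq1.le))).const_mul l).add
    ((hone.rpow_const (p := -((n - p) / p)) (Or.inl (by positivity))).mul hmin)).rpow_const
      (p := p) (Or.inr hp.le)
  convert h using 2
  rw [mul_zero, add_zero, Real.mul_rpow hl (by positivity), Real.mul_rpow (by positivity)
    (by positivity), ← Real.rpow_mul (by positivity), ← Real.rpow_mul (by positivity),
    neg_mul, div_mul_cancel₀ _ hp.ne', show (q - 1) * p = q by
      linarith [hpq.mul_eq_add], mul_comm (‖x‖ ^ q)]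

theorem sobolevC_le {n : ℕ} (hn : 2 ≤ n) {p q r C : ℝ}
    (hpq : p.HolderConjugate q) (hpn : p < n) (hr : 1 < r) (hrp : 1 / r = 1 / p - 1 / n)
    (hC : ∀ u : EuclideanSpace ℝ (Fin n) → ℝ, ContDiff ℝ (⊤ : ℕ∞) u → HasCompactSupport u →
      (∫ x, |u x| ^ r) ^ (1 / r) ≤ C * (∫ x, ‖fderiv ℝ u x‖ ^ p) ^ (1 / p)) :
    sobolevC n p ≤ C := by
  obtain ⟨h0, -, -, hI0, -, hI1, -⟩ := integrals_one_add_norm_rpow hn hpq hpn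
  rw [sobolevC_eq hn hpq hpn hrp]
  have hp := hpq.pos
  have hq1 := hpq.symm.lt
  have hq := hpq.symm.pos
  have hr0 : 0 < r := by linarith
  have hn0 : (0 : ℝ) < n := by positivity
  have hnp : 0 < (n : ℝ) - p := by linarith
  have hp1 : 0 < p - 1 := by linarith [hpq.lt]
  have hγ : 0 < (n - p) / p := by positivity
  obtain ⟨M, hM, hχ⟩ := exists_cutoff n
  have hk1 : ∀ k : ℕ, 1 ≤ (k : ℝ) + 1 := fun k => by linarith [show (0 : ℝ) ≤ k by positivity]
  choose χ hχs hχc hχ01 hχ1 hχd using fun k : ℕ => hχ (k + 1) (hk1 k)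
  set w : ℕ → EuclideanSpace ℝ (Fin n) → ℝ := fun k x =>
    (1 + √(‖x‖ ^ 2 + 1 / ((k : ℝ) + 1)) ^ q) ^ (-((n - p) / p)) with hw
  have hws := fun k : ℕ => contDiff_one_add_sqrt_rpow (n := n) (δ := 1 / ((k : ℝ) + 1)) hq1 hγ
    (by positivity)
  have hw0 : ∀ k x, 0 ≤ w k x := fun k x => by positivity
  have hle : ∀ (k : ℕ) (x : EuclideanSpace ℝ (Fin n)), ‖x‖ ≤ √(‖x‖ ^ 2 + 1 / ((k : ℝ) + 1)) :=
    fun k x => Real.le_sqrt_of_sq_le (by linarith [show 0 ≤ 1 / ((k : ℝ) + 1) by positivity])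
  have hwr : ∀ s : ℝ, 0 ≤ s → ((1 + s ^ q) ^ (-(((n : ℝ) - p) / p))) ^ r =
      (1 + s ^ q) ^ (-(n : ℝ)) := fun s hs => by
    rw [← Real.rpow_mul (by positivity)]
    congr 1
    field_simp at hrp ⊢
    linarith
  have hus : ∀ k, ContDiff ℝ (⊤ : ℕ∞) (w k * χ k) := fun k => (hws k).1.mul (hχs k)
  have huc : ∀ k, HasCompactSupport (w k * χ k) := fun k => (hχc k).mul_left
  -- the critical norms of the truncations converge
  have hlimU : Filter.Tendsto (fun k => ∫ x, |(w k * χ k) x| ^ r) Filter.atTop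
      (nhds (∫ x : EuclideanSpace ℝ (Fin n), (1 + ‖x‖ ^ q) ^ (-(n : ℝ)))) := by
    refine tendsto_integral_of_dominated_convergence _
      (fun k => (((hus k).continuous.abs.rpow_const
        fun x => Or.inr hr0.le)).aestronglyMeasurable) h0
      (fun k => Filter.Eventually.of_forall fun x => ?_) (Filter.Eventually.of_forall fun x => ?_)
    · rw [Real.norm_of_nonneg (by positivity), Pi.mul_apply,
        abs_of_nonneg (mul_nonneg (hw0 k x) (hχ01 k x).1), ← hwr _ (norm_nonneg x)]
      refine Real.rpow_le_rpow (mul_nonneg (hw0 k x) (hχ01 k x).1)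
        ((mul_le_of_le_one_right (hw0 k x) (hχ01 k x).2).trans ?_) hr0.le
      refine Real.rpow_le_rpow_of_nonpos (by positivity) ?_ (by linarith)
      gcongr
      exact hle k x
    · have hρ := tendsto_sqrt_sq_add_inv (norm_nonneg x)
      have h := (((hρ.rpow_const (Or.inr hq.le)).const_add 1).rpow_const
        (p := -((n - p) / p)) (Or.inl (by positivity))).rpow_const (p := r) (Or.inr hr0.le)
      rw [hwr _ (norm_nonneg x)] at h
      refine h.congr' ?_
      obtain ⟨k₀, hk₀⟩ := exists_nat_ge ‖x‖
      filter_upwards [Filter.eventually_ge_atTop k₀] with k hk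
      have : (k₀ : ℝ) ≤ k := by exact_mod_cast hk
      rw [Pi.mul_apply, hχ1 k x (by linarith), mul_one, abs_of_nonneg (hw0 k x)]
  set l := (n - p) / p * q with hldef
  have hl : 0 ≤ l := by positivity
  obtain ⟨hGint, hlimG⟩ := tendsto_integral_gradient_bound hn hpq hpn hl hM
  have hder : ∀ k x, ‖fderiv ℝ (w k * χ k) x‖ ≤
      l * ((1 + √(‖x‖ ^ 2 + 1 / ((k : ℝ) + 1)) ^ q) ^ (-((n : ℝ) / p)) *
        √(‖x‖ ^ 2 + 1 / ((k : ℝ) + 1)) ^ (q - 1)) +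
      (1 + √(‖x‖ ^ 2 + 1 / ((k : ℝ) + 1)) ^ q) ^ (-((n - p) / p)) *
        min (M / ((k : ℝ) + 1)) (3 * M / (1 + ‖x‖)) := fun k x => by
    rw [fderiv_mul ((hws k).1.differentiable (by simp) x) ((hχs k).differentiable (by simp) x),
      add_comm]
    refine (norm_add_le _ _).trans (add_le_add ?_ ?_)
    · rw [norm_smul, Real.norm_of_nonneg (hχ01 k x).1]
      refine (mul_le_of_le_one_left (norm_nonneg _) (hχ01 k x).2).trans
        (((hws k).2 x).trans_eq ?_)
      rw [hldef]
      congr 4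
      field_simp
      ring
    · rw [norm_smul, Real.norm_of_nonneg (hw0 k x)]
      exact mul_le_mul_of_nonneg_left (hχd k x) (hw0 k x)
  have hC0 : 0 ≤ C := by
    by_contra! hC0
    have h : ∀ k, (∫ x, |(w k * χ k) x| ^ r) ^ (1 / r) ≤ 0 := fun k =>
      (hC _ (hus k) (huc k)).trans (mul_nonpos_of_nonpos_of_nonneg hC0.le
        (Real.rpow_nonneg (integral_nonneg fun x => by positivity) _))
    have := le_of_tendsto' (hlimU.rpow_const (p := 1 / r) (Or.inl hI0.ne')) h
    exact absurd this (not_le.2 (Real.rpow_pos_of_pos hI0 _))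
  have hlim := le_of_tendsto_of_tendsto' (hlimU.rpow_const (p := 1 / r) (Or.inl hI0.ne'))
    ((hlimG.rpow_const (p := 1 / p) (Or.inr (by positivity))).const_mul C) fun k =>
      (hC _ (hus k) (huc k)).trans (mul_le_mul_of_nonneg_left (Real.rpow_le_rpow
        (integral_nonneg fun x => Real.rpow_nonneg (norm_nonneg _) p)
        (integral_mono_of_nonneg
          (Filter.Eventually.of_forall fun x => Real.rpow_nonneg (norm_nonneg _) p)
          (hGint k) (Filter.Eventually.of_forall fun x =>
            Real.rpow_le_rpow (norm_nonneg _) (hder k x) hp.le)) (by positivity)) hC0)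
  have hI1pos : 0 < ∫ x : EuclideanSpace ℝ (Fin n), ‖x‖ ^ q * (1 + ‖x‖ ^ q) ^ (-(n : ℝ)) := by
    rw [hI1]; positivity
  have hlq : l = (n - p) / (p - 1) := by
    rw [hldef]
    field_simp
    linear_combination hpq.sub_one_mul_conj
  rw [Real.mul_rpow (by positivity) hI1pos.le, ← Real.rpow_mul hl, mul_one_div_cancel hp.ne',
    Real.rpow_one, hlq] at hlim
  rw [Real.rpow_neg hI1pos.le]
  set I1 := (∫ x : EuclideanSpace ℝ (Fin n), ‖x‖ ^ q * (1 + ‖x‖ ^ q) ^ (-(n : ℝ))) ^ (1 / p)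
  have hI1' : 0 < I1 := by positivity
  calc _ ≤ (p - 1) / (n - p) * I1⁻¹ * (C * ((n - p) / (p - 1) * I1)) := by gcongr
    _ = C := by field_simp

/-- **The sharp Sobolev inequality** (Aubin 1976; Talenti 1976). For `n ≥ 2`,
`1 < p < n`, `p* = np/(n-p)` and every smooth compactly supported `u : ℝⁿ → ℝ`,
`‖u‖_{L^{p*}} ≤ C₂(n,p) ‖∇u‖_{L^p}`, and `C₂(n,p)` is the smallest such constant. -/
theorem sobolev_inequality_sharp (n : ℕ) (hn : 2 ≤ n) (p : ℝ) (hp : 1 < p)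
    (hpn : p < n) :
    (∀ u : EuclideanSpace ℝ (Fin n) → ℝ,
        ContDiff ℝ (⊤ : ℕ∞) u → HasCompactSupport u →
        (∫ x, |u x| ^ ((n : ℝ) * p / ((n : ℝ) - p))) ^ (((n : ℝ) - p) / ((n : ℝ) * p)) ≤
          sobolevC n p * (∫ x, ‖fderiv ℝ u x‖ ^ p) ^ (1 / p)) ∧
    (∀ C : ℝ,
      (∀ u : EuclideanSpace ℝ (Fin n) → ℝ,
        ContDiff ℝ (⊤ : ℕ∞) u → HasCompactSupport u →
        (∫ x, |u x| ^ ((n : ℝ) * p / ((n : ℝ) - p))) ^ (((n : ℝ) - p) / ((n : ℝ) * p)) ≤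
          C * (∫ x, ‖fderiv ℝ u x‖ ^ p) ^ (1 / p)) →
      sobolevC n p ≤ C) := by
  have hpq := Real.HolderConjugate.conjExponent hp
  have hn0 : (0 : ℝ) < n := by positivity
  have hnp : 0 < (n : ℝ) - p := by linarith
  have hr : 1 < (n : ℝ) * p / (n - p) := by
    rw [one_lt_div hnp]
    nlinarith
  have hrp : 1 / ((n : ℝ) * p / (n - p)) = 1 / p - 1 / n := by
    field_simp
  rw [← one_div_div ((n : ℝ) * p)]
  exact ⟨fun u hu huc => sobolev_inequality hn hpq hpn hr hrp (hu.of_le (by simp)) huc,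
    fun C hC => sobolevC_le hn hpq hpn hr hrp hC⟩
end

section
/- Let a > 0 and let T ⊂ ℝ² be the open equilateral triangle with vertices (0,0), (a,0) and (a/2, a√3/2). For every smooth function u : ℝ² → ℝ with compact support contained in T, (16/3)(π/a)² ∫_T u² dx ≤ ∫_T |∇u|² dx, and the constant (16/3)(π/a)² is the largest constant for which this inequality holds for all such u. -/
open Real MeasureTheory Set

/-- The point of the Euclidean plane with coordinates `(x, y)`. -/
noncomputable def pt2 (x y : ℝ) : EuclideanSpace ℝ (Fin 2) :=
  (WithLp.equiv 2 (Fin 2 → ℝ)).symm ![x, y]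

/-- The open equilateral triangle with vertices `(0,0)`, `(a,0)` and `(a/2, a√3/2)`. -/
noncomputable def equilateralTriangle (a : ℝ) : Set (EuclideanSpace ℝ (Fin 2)) :=
  interior (convexHull ℝ {pt2 0 0, pt2 a 0, pt2 (a / 2) (a * Real.sqrt 3 / 2)})

theorem norm_sq_eq_sum_apply_single {ι : Type*} [Fintype ι] [DecidableEq ι]
    (L : EuclideanSpace ℝ ι →L[ℝ] ℝ) :
    ‖L‖ ^ 2 = ∑ i, L (EuclideanSpace.single i 1) ^ 2 := by
  set y := (InnerProductSpace.toDual ℝ (EuclideanSpace ℝ ι)).symm L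
  have hL : L = InnerProductSpace.toDual ℝ _ y := by simp [y]
  rw [hL, LinearIsometryEquiv.norm_map, EuclideanSpace.norm_sq_eq]
  simp [EuclideanSpace.inner_single_right]

theorem integral_fderiv_apply_eq_zero {ι : Type*} [Fintype ι] {g : EuclideanSpace ℝ ι → ℝ}
    (hg : ContDiff ℝ 1 g) (hc : HasCompactSupport g) (v : EuclideanSpace ℝ ι) :
    ∫ x, fderiv ℝ g x v = 0 := by
  have h := integral_mul_fderiv_eq_neg_fderiv_mul_of_integrable (μ := volume)
    (f := fun _ : EuclideanSpace ℝ ι => (1 : ℝ)) (g := g) (v := v) (by simp) ?_ ?_ (by simp)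
    (fun x _ => hg.differentiable one_ne_zero x)
  · simpa using h
  · simpa using ((hg.continuous_fderiv one_ne_zero).clm_apply
      continuous_const).integrable_of_hasCompactSupport (hc.fderiv_apply ℝ v)
  · simpa using hg.continuous.integrable_of_hasCompactSupport hc

/-- The ground state representation of the Dirichlet form. -/
theorem integral_norm_fderiv_mul_sq {ι : Type*} [Fintype ι] [DecidableEq ι] {l : ℝ}
    {φ f : EuclideanSpace ℝ ι → ℝ} (hφ : ContDiff ℝ (⊤ : ℕ∞) φ)
    (hl : ∀ x, ∑ i, fderiv ℝ (fun y => fderiv ℝ φ y (EuclideanSpace.single i 1)) x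
      (EuclideanSpace.single i 1) = -l * φ x)
    (hf : ContDiff ℝ (⊤ : ℕ∞) f) (hc : HasCompactSupport f) :
    ∫ x, ‖fderiv ℝ (fun y => φ y * f y) x‖ ^ 2 =
      l * (∫ x, (φ x * f x) ^ 2) + ∫ x, φ x ^ 2 * ‖fderiv ℝ f x‖ ^ 2 := by
  have hφd : Differentiable ℝ φ := hφ.differentiable (by simp)
  have hfd : Differentiable ℝ f := hf.differentiable (by simp)
  have hD : ∀ i, ContDiff ℝ (⊤ : ℕ∞) (fun y => fderiv ℝ φ y (EuclideanSpace.single i 1)) :=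
    fun i => (hφ.fderiv_right (by simp)).clm_apply contDiff_const
  set G : ι → EuclideanSpace ℝ ι → ℝ :=
    fun i x => f x * (f x * (φ x * fderiv ℝ φ x (EuclideanSpace.single i 1)))
  have hGs : ∀ i, ContDiff ℝ (⊤ : ℕ∞) (G i) := fun i => hf.mul (hf.mul (hφ.mul (hD i)))
  have hGc : ∀ i, HasCompactSupport (G i) := fun i => hc.mul_right
  have hGi : ∀ i, Integrable (fun x => fderiv ℝ (G i) x (EuclideanSpace.single i 1)) := fun i =>
    (((hGs i).continuous_fderiv (by simp)).clm_apply
      continuous_const).integrable_of_hasCompactSupport ((hGc i).fderiv_apply ℝ _)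
  have h1 : Integrable (fun x => l * (φ x * f x) ^ 2) := by
    refine Continuous.integrable_of_hasCompactSupport ?_ ?_
    · exact continuous_const.mul ((hφ.continuous.mul hf.continuous).pow 2)
    · exact hc.mono fun x hx => by contrapose! hx; simp_all
  have h2 : Integrable (fun x => φ x ^ 2 * ‖fderiv ℝ f x‖ ^ 2) := by
    refine Continuous.integrable_of_hasCompactSupport ?_ ?_
    · exact (hφ.continuous.pow 2).mul ((hf.continuous_fderiv (by simp)).norm.pow 2)
    · exact (hc.fderiv ℝ).mono fun x hx => by contrapose! hx; simp_all
  have h12 : Integrable (fun x => l * (φ x * f x) ^ 2 + φ x ^ 2 * ‖fderiv ℝ f x‖ ^ 2) := h1.add h2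
  have key : ∀ x, ‖fderiv ℝ (fun y => φ y * f y) x‖ ^ 2 =
      (∑ i, fderiv ℝ (G i) x (EuclideanSpace.single i 1)) +
        (l * (φ x * f x) ^ 2 + φ x ^ 2 * ‖fderiv ℝ f x‖ ^ 2) := by
    intro x
    have e1 : ∀ i, fderiv ℝ (G i) x (EuclideanSpace.single i 1) =
        2 * f x * φ x * fderiv ℝ f x (EuclideanSpace.single i 1) *
          fderiv ℝ φ x (EuclideanSpace.single i 1) +
        f x ^ 2 * fderiv ℝ φ x (EuclideanSpace.single i 1) ^ 2 +
        f x ^ 2 * φ x * fderiv ℝ (fun y => fderiv ℝ φ y (EuclideanSpace.single i 1)) x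
      (EuclideanSpace.single i 1) := by
      intro i
      have hDd := (hD i).differentiable (by simp) x
      have h := ((hfd x).hasFDerivAt.mul ((hfd x).hasFDerivAt.mul
        ((hφd x).hasFDerivAt.mul hDd.hasFDerivAt))).fderiv
      have h' : fderiv ℝ (G i) x = _ := h
      rw [h']
      simp
      ring
    have e2 : fderiv ℝ (fun y => φ y * f y) x = φ x • fderiv ℝ f x + f x • fderiv ℝ φ x :=
      ((hφd x).hasFDerivAt.mul (hfd x).hasFDerivAt).fderiv
    have e3 : l * (φ x * f x) ^ 2 = - (f x ^ 2 * φ x * (-l * φ x)) := by ring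
    rw [norm_sq_eq_sum_apply_single, norm_sq_eq_sum_apply_single, e2, e3, ← hl x, Finset.mul_sum,
      Finset.mul_sum, ← Finset.sum_neg_distrib, ← Finset.sum_add_distrib, ← Finset.sum_add_distrib]
    refine Finset.sum_congr rfl fun i _ => ?_
    rw [e1 i]
    simp
    ring
  simp_rw [key]
  rw [integral_add (integrable_finsetSum _ fun i _ => hGi i) h12, integral_add h1 h2,
    integral_finsetSum _ fun i _ => hGi i, integral_const_mul]
  simp [integral_fderiv_apply_eq_zero ((hGs _).of_le (by simp)) (hGc _)]

theorem contDiff_of_forall_mem_tsupport {E : Type*} [NormedAddCommGroup E] [NormedSpace ℝ E]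
    {n : WithTop ℕ∞} {f : E → ℝ} (h : ∀ x ∈ tsupport f, ContDiffAt ℝ n f x) :
    ContDiff ℝ n f := by
  refine contDiff_iff_contDiffAt.2 fun x => ?_
  by_cases hx : x ∈ tsupport f
  · exact h x hx
  · exact contDiffAt_const.congr_of_eventuallyEq (notMem_tsupport_iff_eventuallyEq.1 hx)

theorem setIntegral_sq_eq_integral_of_tsupport_subset {ι : Type*} [Fintype ι]
    {T : Set (EuclideanSpace ℝ ι)} {u : EuclideanSpace ℝ ι → ℝ} (h : tsupport u ⊆ T) :
    ∫ x in T, u x ^ 2 = ∫ x, u x ^ 2 :=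
  setIntegral_eq_integral_of_forall_compl_eq_zero fun x hx => by
    rw [image_eq_zero_of_notMem_tsupport fun h' => hx (h h')]; simp

theorem setIntegral_norm_fderiv_sq_eq_integral_of_tsupport_subset {ι : Type*} [Fintype ι]
    {T : Set (EuclideanSpace ℝ ι)} {u : EuclideanSpace ℝ ι → ℝ} (h : tsupport u ⊆ T) :
    ∫ x in T, ‖fderiv ℝ u x‖ ^ 2 = ∫ x, ‖fderiv ℝ u x‖ ^ 2 :=
  setIntegral_eq_integral_of_forall_compl_eq_zero fun x hx => by
    rw [fderiv_of_notMem_tsupport (𝕜 := ℝ) fun h' => hx (h h')]; simp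

/-- Barta inequality: a function that is positive on `T` and satisfies `-Δφ = l φ` bounds the
Dirichlet energy of test functions from below. -/
theorem mul_setIntegral_sq_le_setIntegral_norm_fderiv_sq {ι : Type*} [Fintype ι] [DecidableEq ι]
    {l : ℝ} {T : Set (EuclideanSpace ℝ ι)} {φ u : EuclideanSpace ℝ ι → ℝ}
    (hφ : ContDiff ℝ (⊤ : ℕ∞) φ)
    (hl : ∀ x, ∑ i, fderiv ℝ (fun y => fderiv ℝ φ y (EuclideanSpace.single i 1)) x
      (EuclideanSpace.single i 1) = -l * φ x)
    (hpos : ∀ x ∈ T, 0 < φ x) (hu : ContDiff ℝ (⊤ : ℕ∞) u) (hc : HasCompactSupport u)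
    (hT : tsupport u ⊆ T) :
    l * ∫ x in T, u x ^ 2 ≤ ∫ x in T, ‖fderiv ℝ u x‖ ^ 2 := by
  have hsub : tsupport (fun x => u x / φ x) ⊆ tsupport u :=
    closure_mono fun x hx => by contrapose! hx; simp_all
  have hf : ContDiff ℝ (⊤ : ℕ∞) (fun x => u x / φ x) := contDiff_of_forall_mem_tsupport fun x hx =>
    hu.contDiffAt.div hφ.contDiffAt (hpos x (hT (hsub hx))).ne'
  have hfc : HasCompactSupport (fun x => u x / φ x) :=
    hc.mono fun x hx => by contrapose! hx; simp_all
  have huf : (fun x => φ x * (u x / φ x)) = u := by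
    funext x
    by_cases hx : x ∈ T
    · have := (hpos x hx).ne'
      field_simp
    · rw [image_eq_zero_of_notMem_tsupport fun h' => hx (hT h')]; simp
  have h := integral_norm_fderiv_mul_sq hφ hl hf hfc
  have huf' : ∀ x, φ x * (u x / φ x) = u x := congrFun huf
  rw [huf] at h
  simp_rw [huf'] at h
  rw [setIntegral_sq_eq_integral_of_tsupport_subset hT,
    setIntegral_norm_fderiv_sq_eq_integral_of_tsupport_subset hT, h]
  have : 0 ≤ ∫ x, φ x ^ 2 * ‖fderiv ℝ (fun x => u x / φ x) x‖ ^ 2 :=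
    integral_nonneg fun x => by positivity
  linarith

theorem exists_abs_mul_deriv_smoothTransition_sub_one_le :
    ∃ M, ∀ t : ℝ, |t * deriv smoothTransition (t - 1)| ≤ M := by
  have hcont : Continuous fun t : ℝ => t * deriv smoothTransition (t - 1) :=
    continuous_id.mul (((smoothTransition.contDiff (n := 1)).continuous_deriv le_rfl).comp
      (continuous_id.sub continuous_const))
  have hsupp : HasCompactSupport fun t : ℝ => t * deriv smoothTransition (t - 1) := by
    refine HasCompactSupport.intro (isCompact_Icc (a := (1 : ℝ)) (b := 2)) fun t ht => ?_
    have h0 : deriv smoothTransition (t - 1) = 0 := by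
      rw [mem_Icc, not_and_or, not_le, not_le] at ht
      rcases ht with ht | ht
      · have : smoothTransition =ᶠ[nhds (t - 1)] fun _ => 0 := by
          filter_upwards [Iio_mem_nhds (show t - 1 < 0 by linarith)] with s hs
          exact smoothTransition.zero_of_nonpos (le_of_lt hs)
        rw [this.deriv_eq, deriv_const]
      · have : smoothTransition =ᶠ[nhds (t - 1)] fun _ => 1 := by
          filter_upwards [Ioi_mem_nhds (show 1 < t - 1 by linarith)] with s hs
          exact smoothTransition.one_of_one_le (le_of_lt hs)
        rw [this.deriv_eq, deriv_const]
    rw [h0, mul_zero]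
  exact hcont.bounded_above_of_compact_support hsupp

/-- The cutoff of the superlevel sets of `φ` inside `T`. -/
noncomputable def levelCutoff {E : Type*} (T : Set E) (φ : E → ℝ) (n : ℕ) : E → ℝ :=
  T.indicator fun x => smoothTransition (n * φ x - 1)

theorem levelCutoff_eq_one {E : Type*} {T : Set E} {φ : E → ℝ} {x : E} (hx : x ∈ T)
    {n : ℕ} (hn : 2 ≤ n * φ x) :
    levelCutoff T φ n x = 1 := by
  rw [levelCutoff, indicator_of_mem hx]
  exact smoothTransition.one_of_one_le (by linarith)

theorem abs_levelCutoff_le_one {E : Type*} {T : Set E} {φ : E → ℝ} (x : E)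
    (n : ℕ) : |levelCutoff T φ n x| ≤ 1 := by
  by_cases hx : x ∈ T
  · rw [levelCutoff, indicator_of_mem hx, abs_of_nonneg (smoothTransition.nonneg _)]
    exact smoothTransition.le_one _
  · rw [levelCutoff, indicator_of_notMem hx]; simp

section LevelCutoff

variable {E : Type*} [NormedAddCommGroup E] [NormedSpace ℝ E] {T : Set E} {φ : E → ℝ}

omit [NormedSpace ℝ E] in
theorem tsupport_levelCutoff_subset_inter (hφ : Continuous φ) (n : ℕ) :
    tsupport (levelCutoff T φ n) ⊆ closure T ∩ {x | 1 ≤ n * φ x} := by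
  refine closure_minimal (fun x hx => ?_)
    (isClosed_closure.inter (isClosed_le continuous_const (continuous_const.mul hφ)))
  have hxT : x ∈ T := mem_of_indicator_ne_zero hx
  refine ⟨subset_closure hxT, ?_⟩
  by_contra h
  apply hx
  rw [levelCutoff, indicator_of_mem hxT]
  exact smoothTransition.zero_of_nonpos (by linarith [lt_of_not_ge (show ¬ 1 ≤ n * φ x from h)])

omit [NormedSpace ℝ E] in
theorem tsupport_levelCutoff_subset (hφ : Continuous φ)
    (hbd : ∀ x ∈ closure T, x ∉ T → φ x = 0) (n : ℕ) : tsupport (levelCutoff T φ n) ⊆ T := by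
  intro x hx
  obtain ⟨h1, h2⟩ := tsupport_levelCutoff_subset_inter hφ n hx
  by_contra h
  have h3 : 1 ≤ n * φ x := h2
  rw [hbd x h1 h, mul_zero] at h3
  linarith

omit [NormedSpace ℝ E] in
theorem levelCutoff_eventuallyEq (hT : IsOpen T) {x : E} (hx : x ∈ T) (n : ℕ) :
    levelCutoff T φ n =ᶠ[nhds x] fun x => smoothTransition (n * φ x - 1) := by
  filter_upwards [hT.mem_nhds hx] with y hy
  exact indicator_of_mem hy _

theorem contDiff_levelCutoff (hT : IsOpen T) (hφ : ContDiff ℝ (⊤ : ℕ∞) φ)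
    (hbd : ∀ x ∈ closure T, x ∉ T → φ x = 0) (n : ℕ) :
    ContDiff ℝ (⊤ : ℕ∞) (levelCutoff T φ n) :=
  contDiff_of_forall_mem_tsupport fun _ hx =>
    ContDiffAt.congr_of_eventuallyEq
      (smoothTransition.contDiff.comp ((contDiff_const.mul hφ).sub contDiff_const)).contDiffAt
      (levelCutoff_eventuallyEq hT (tsupport_levelCutoff_subset hφ.continuous hbd n hx) n)

theorem fderiv_levelCutoff (hT : IsOpen T) (hφ : Differentiable ℝ φ) {x : E} (hx : x ∈ T) (n : ℕ) :
    fderiv ℝ (levelCutoff T φ n) x =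
      deriv smoothTransition (n * φ x - 1) • ((n : ℝ) • fderiv ℝ φ x) := by
  rw [(levelCutoff_eventuallyEq hT hx n).fderiv_eq]
  have hs : HasDerivAt smoothTransition (deriv smoothTransition (n * φ x - 1)) (n * φ x - 1) :=
    ((smoothTransition.contDiff (n := 1)).differentiable one_ne_zero _).hasDerivAt
  exact (hs.comp_hasFDerivAt x (((hφ x).hasFDerivAt.const_mul (n : ℝ)).sub_const 1)).fderiv

theorem fderiv_levelCutoff_eq_zero (hT : IsOpen T) (hφ : Continuous φ) {x : E} (hx : x ∈ T) {n : ℕ}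
    (hn : 2 < n * φ x) : fderiv ℝ (levelCutoff T φ n) x = 0 := by
  have : levelCutoff T φ n =ᶠ[nhds x] fun _ => 1 := by
    filter_upwards [hT.mem_nhds hx, (isOpen_lt continuous_const
      (continuous_const.mul hφ)).mem_nhds hn] with y hy hy'
    exact levelCutoff_eq_one hy (le_of_lt hy')
  rw [this.fderiv_eq]; simp

end LevelCutoff

/-- A positive solution of `-Δφ = l φ` on a bounded open set vanishing on the boundary bounds the
constants in the Poincaré inequality from above. -/
theorem le_of_forall_mul_setIntegral_sq_le {ι : Type*} [Fintype ι] [DecidableEq ι]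
    {c l : ℝ} {T : Set (EuclideanSpace ℝ ι)} {φ : EuclideanSpace ℝ ι → ℝ}
    (hT : IsOpen T) (hTb : Bornology.IsBounded T) (hTn : T.Nonempty)
    (hφ : ContDiff ℝ (⊤ : ℕ∞) φ)
    (hl : ∀ x, ∑ i, fderiv ℝ (fun y => fderiv ℝ φ y (EuclideanSpace.single i 1)) x
      (EuclideanSpace.single i 1) = -l * φ x)
    (hpos : ∀ x ∈ T, 0 < φ x) (hbd : ∀ x ∈ closure T, x ∉ T → φ x = 0)
    (h : ∀ u : EuclideanSpace ℝ ι → ℝ, ContDiff ℝ (⊤ : ℕ∞) u → HasCompactSupport u →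
      tsupport u ⊆ T → c * ∫ x in T, u x ^ 2 ≤ ∫ x in T, ‖fderiv ℝ u x‖ ^ 2) :
    c ≤ l := by
  have hcl : IsCompact (closure T) := hTb.isCompact_closure
  have hφd : Differentiable ℝ φ := hφ.differentiable (by simp)
  have hfin : IsFiniteMeasure (volume.restrict T) := ⟨by
    rw [Measure.restrict_apply_univ]; exact hTb.measure_lt_top⟩
  have hχ := contDiff_levelCutoff hT hφ hbd
  have hχT := tsupport_levelCutoff_subset hφ.continuous hbd
  have hχc : ∀ n, HasCompactSupport (levelCutoff T φ n) := fun n =>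
    hcl.of_isClosed_subset (isClosed_tsupport _) ((hχT n).trans subset_closure)
  have hev : ∀ x ∈ T, ∀ᶠ n : ℕ in Filter.atTop, 2 < n * φ x := fun x hx =>
    (tendsto_natCast_atTop_atTop.atTop_mul_const (hpos x hx)).eventually_gt_atTop 2
  have hineq : ∀ n, (c - l) * ∫ x in T, (φ x * levelCutoff T φ n x) ^ 2 ≤
      ∫ x in T, φ x ^ 2 * ‖fderiv ℝ (levelCutoff T φ n) x‖ ^ 2 := by
    intro n
    have hsub : tsupport (fun x => φ x * levelCutoff T φ n x) ⊆ T :=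
      (tsupport_mul_subset_right (f := φ)).trans (hχT n)
    have h1 := h _ (hφ.mul (hχ n)) (hχc n).mul_left hsub
    have h2 : ∫ x in T, φ x ^ 2 * ‖fderiv ℝ (levelCutoff T φ n) x‖ ^ 2 =
        ∫ x, φ x ^ 2 * ‖fderiv ℝ (levelCutoff T φ n) x‖ ^ 2 :=
      setIntegral_eq_integral_of_forall_compl_eq_zero fun x hx => by
        rw [fderiv_of_notMem_tsupport (𝕜 := ℝ) fun h' => hx (hχT n h')]; simp
    rw [setIntegral_norm_fderiv_sq_eq_integral_of_tsupport_subset hsub,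
      integral_norm_fderiv_mul_sq hφ hl (hχ n) (hχc n), ← h2,
      ← setIntegral_sq_eq_integral_of_tsupport_subset hsub] at h1
    linarith
  obtain ⟨B, hB⟩ := hcl.exists_bound_of_continuousOn hφ.continuous.continuousOn
  obtain ⟨K, hK⟩ := hcl.exists_bound_of_continuousOn
    (hφ.continuous_fderiv (by simp)).continuousOn
  obtain ⟨M, hM⟩ := exists_abs_mul_deriv_smoothTransition_sub_one_le
  have hlim1 : Filter.Tendsto (fun n => ∫ x in T, (φ x * levelCutoff T φ n x) ^ 2) Filter.atTop
      (nhds (∫ x in T, φ x ^ 2)) := by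
    refine tendsto_integral_of_dominated_convergence (fun _ => B ^ 2) (fun n => ?_)
      (integrable_const _) (fun n => ?_) ?_
    · exact ((hφ.continuous.mul (hχ n).continuous).pow 2).aestronglyMeasurable
    · refine (ae_restrict_iff' hT.measurableSet).2 (.of_forall fun x hx => ?_)
      have h1 := hB x (subset_closure hx)
      have h2 := abs_levelCutoff_le_one (T := T) (φ := φ) x n
      rw [norm_pow, norm_mul]
      have : ‖φ x‖ * ‖levelCutoff T φ n x‖ ≤ B * 1 :=
        mul_le_mul h1 h2 (norm_nonneg _) ((norm_nonneg _).trans h1)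
      rw [mul_one] at this
      gcongr
    · refine (ae_restrict_iff' hT.measurableSet).2 (.of_forall fun x hx => ?_)
      refine tendsto_const_nhds.congr' ?_
      filter_upwards [hev x hx] with n hn
      rw [levelCutoff_eq_one hx hn.le, mul_one]
  have hlim2 : Filter.Tendsto (fun n => ∫ x in T, φ x ^ 2 * ‖fderiv ℝ (levelCutoff T φ n) x‖ ^ 2)
      Filter.atTop (nhds (∫ _ in T, 0)) := by
    refine tendsto_integral_of_dominated_convergence (fun _ => (M * K) ^ 2) (fun n => ?_)
      (integrable_const _) (fun n => ?_) ?_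
    · exact ((hφ.continuous.pow 2).mul
        (((hχ n).continuous_fderiv (by simp)).norm.pow 2)).aestronglyMeasurable
    · refine (ae_restrict_iff' hT.measurableSet).2 (.of_forall fun x hx => ?_)
      have h1 := hK x (subset_closure hx)
      have h2 := hM (n * φ x)
      have h3 : ‖φ x ^ 2 * ‖fderiv ℝ (levelCutoff T φ n) x‖ ^ 2‖ =
          (|n * φ x * deriv smoothTransition (n * φ x - 1)| * ‖fderiv ℝ φ x‖) ^ 2 := by
        rw [fderiv_levelCutoff hT hφd hx, norm_smul, norm_smul,
          Real.norm_of_nonneg (by positivity), mul_pow, mul_pow, mul_pow, sq_abs,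
          Real.norm_eq_abs, Real.norm_eq_abs, sq_abs, sq_abs]
        ring
      rw [h3]
      have : 0 ≤ M := (abs_nonneg _).trans h2
      gcongr
    · refine (ae_restrict_iff' hT.measurableSet).2 (.of_forall fun x hx => ?_)
      refine tendsto_const_nhds.congr' ?_
      filter_upwards [hev x hx] with n hn
      rw [fderiv_levelCutoff_eq_zero hT hφ.continuous hx hn]; simp
  have hle : (c - l) * ∫ x in T, φ x ^ 2 ≤ 0 := by
    simpa using le_of_tendsto_of_tendsto' (hlim1.const_mul (c - l)) hlim2 hineq
  have hint : IntegrableOn (fun x => φ x ^ 2) T :=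
    ((hφ.continuous.pow 2).continuousOn.integrableOn_compact hcl).mono_set subset_closure
  have hsq : 0 < ∫ x in T, φ x ^ 2 := by
    rw [setIntegral_pos_iff_support_of_nonneg_ae (.of_forall fun x => by positivity) hint]
    have : Function.support (fun x => φ x ^ 2) ∩ T = T :=
      inter_eq_right.2 fun x hx => pow_ne_zero 2 (hpos x hx).ne'
    rw [this]
    exact hT.measure_pos _ hTn
  nlinarith

/-- A sum of plane waves `sin (2π (p k + L k x))`. -/
noncomputable def sumSinAffine {ι κ : Type*} [Fintype ι] [Fintype κ] (p : κ → ℝ)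
    (L : κ → EuclideanSpace ℝ ι →L[ℝ] ℝ) (x : EuclideanSpace ℝ ι) : ℝ :=
  ∑ k, sin (2 * π * (p k + L k x))

section SumSinAffine

variable {ι κ : Type*} [Fintype ι] [Fintype κ] {p : κ → ℝ} {L : κ → EuclideanSpace ℝ ι →L[ℝ] ℝ}

theorem contDiff_sumSinAffine : ContDiff ℝ (⊤ : ℕ∞) (sumSinAffine p L) :=
  ContDiff.sum fun k _ => contDiff_sin.comp
    (contDiff_const.mul (contDiff_const.add (L k).contDiff))

omit [Fintype κ] in
theorem hasFDerivAt_affine (k : κ) (x : EuclideanSpace ℝ ι) :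
    HasFDerivAt (fun y => 2 * π * (p k + L k y)) ((2 * π) • L k) x :=
  ((L k).hasFDerivAt.const_add (p k)).const_mul (2 * π)

theorem fderiv_sumSinAffine (x v : EuclideanSpace ℝ ι) :
    fderiv ℝ (sumSinAffine p L) x v = ∑ k, 2 * π * L k v * cos (2 * π * (p k + L k x)) := by
  have h : HasFDerivAt (sumSinAffine p L)
      (∑ k, cos (2 * π * (p k + L k x)) • ((2 * π) • L k)) x :=
    HasFDerivAt.fun_sum fun k _ => (hasFDerivAt_affine k x).sin
  rw [h.fderiv]
  simp only [sum_apply, smul_apply, smul_eq_mul]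
  exact Finset.sum_congr rfl fun k _ => by ring

theorem fderiv_fderiv_sumSinAffine (x v : EuclideanSpace ℝ ι) :
    fderiv ℝ (fun y => fderiv ℝ (sumSinAffine p L) y v) x v =
      ∑ k, -(4 * π ^ 2 * L k v ^ 2 * sin (2 * π * (p k + L k x))) := by
  simp_rw [fderiv_sumSinAffine]
  have h : HasFDerivAt (fun y => ∑ k, 2 * π * L k v * cos (2 * π * (p k + L k y)))
      (∑ k, (2 * π * L k v) • (-sin (2 * π * (p k + L k x)) • ((2 * π) • L k))) x :=
    HasFDerivAt.fun_sum fun k _ => (hasFDerivAt_affine k x).cos.const_mul _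
  rw [h.fderiv]
  simp only [sum_apply, smul_apply, smul_eq_mul]
  exact Finset.sum_congr rfl fun k _ => by ring

theorem laplacian_sumSinAffine [DecidableEq ι] {s : ℝ}
    (hs : ∀ k, ∑ i, L k (EuclideanSpace.single i 1) ^ 2 = s) (x : EuclideanSpace ℝ ι) :
    ∑ i, fderiv ℝ (fun y => fderiv ℝ (sumSinAffine p L) y (EuclideanSpace.single i 1)) x
      (EuclideanSpace.single i 1) = -(4 * π ^ 2 * s) * sumSinAffine p L x := by
  simp_rw [fderiv_fderiv_sumSinAffine]
  rw [Finset.sum_comm, sumSinAffine, Finset.mul_sum]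
  refine Finset.sum_congr rfl fun k _ => ?_
  rw [← hs k, Finset.mul_sum, ← Finset.sum_neg_distrib, Finset.sum_mul]
  exact Finset.sum_congr rfl fun i _ => by ring

end SumSinAffine

/-- If `A + B + C = 1` then `∑ sin (2πA) = 4 ∏ sin (πA)`. -/
theorem sin_add_sin_add_sin_eq {A B C : ℝ} (h : A + B + C = 1) :
    sin (2 * π * A) + sin (2 * π * B) + sin (2 * π * C) =
      4 * sin (π * A) * sin (π * B) * sin (π * C) := by
  have hC : π * C = π - (π * A + π * B) := by rw [← eq_sub_iff_add_eq'] at h; rw [h]; ring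
  have h2 : ∀ t, 2 * π * t = 2 * (π * t) := fun t => by ring
  rw [h2, h2, h2, sin_two_mul, sin_two_mul, sin_two_mul, hC, sin_pi_sub, cos_pi_sub, sin_add,
    cos_add]
  have hA := sin_sq_add_cos_sq (π * A)
  have hB := sin_sq_add_cos_sq (π * B)
  generalize sin (π * A) = s at *
  generalize cos (π * A) = c at *
  generalize sin (π * B) = t at *
  generalize cos (π * B) = d at *
  linear_combination (-2 * t * d) * hA + (-2 * s * c) * hB

/-- The linear parts of the barycentric coordinates of the equilateral triangle. -/
noncomputable def triangleLinear (a : ℝ) : Fin 3 → EuclideanSpace ℝ (Fin 2) →L[ℝ] ℝ :=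
  ![-(1 / a) • EuclideanSpace.proj 0 - (1 / (a * √3)) • EuclideanSpace.proj 1,
    (1 / a) • EuclideanSpace.proj 0 - (1 / (a * √3)) • EuclideanSpace.proj 1,
    (2 / (a * √3)) • EuclideanSpace.proj 1]

/-- The barycentric coordinates of the equilateral triangle. -/
noncomputable def triangleCoord (a : ℝ) (k : Fin 3) (x : EuclideanSpace ℝ (Fin 2)) : ℝ :=
  (![1, 0, 0] : Fin 3 → ℝ) k + triangleLinear a k x

theorem triangleCoord_zero (a : ℝ) (x : EuclideanSpace ℝ (Fin 2)) :
    triangleCoord a 0 x = 1 - x 0 / a - x 1 / (a * √3) := by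
  simp [triangleCoord, triangleLinear]; ring

theorem triangleCoord_one (a : ℝ) (x : EuclideanSpace ℝ (Fin 2)) :
    triangleCoord a 1 x = x 0 / a - x 1 / (a * √3) := by
  simp [triangleCoord, triangleLinear]; ring

theorem triangleCoord_two (a : ℝ) (x : EuclideanSpace ℝ (Fin 2)) :
    triangleCoord a 2 x = 2 * x 1 / (a * √3) := by
  simp [triangleCoord, triangleLinear]; ring

theorem triangleCoord_add (a : ℝ) (x : EuclideanSpace ℝ (Fin 2)) :
    triangleCoord a 0 x + triangleCoord a 1 x + triangleCoord a 2 x = 1 := by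
  rw [triangleCoord_zero, triangleCoord_one, triangleCoord_two]; ring

theorem continuous_triangleCoord (a : ℝ) (k : Fin 3) : Continuous (triangleCoord a k) :=
  continuous_const.add (triangleLinear a k).continuous

theorem sum_triangleLinear_single_sq (a : ℝ) (k : Fin 3) :
    ∑ i, triangleLinear a k (EuclideanSpace.single i 1) ^ 2 = 4 / (3 * a ^ 2) := by
  have h3 : (√3 : ℝ) ^ 2 = 3 := sq_sqrt (by norm_num)
  have h3' : (√3 : ℝ)⁻¹ ^ 2 = 3⁻¹ := by rw [inv_pow, h3]
  rw [Fin.sum_univ_two]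
  fin_cases k <;> simp [triangleLinear] <;> ring_nf <;> simp only [h3', inv_pow] <;> ring

theorem triangleLinear_ne_zero {a : ℝ} (ha : 0 < a) (k : Fin 3) : triangleLinear a k ≠ 0 := by
  intro h
  have hs := sum_triangleLinear_single_sq a k
  have : (0 : ℝ) < 4 / (3 * a ^ 2) := by positivity
  rw [← hs, h] at this
  simp at this

theorem closedTriangle_subset {a : ℝ} (ha : 0 < a) :
    convexHull ℝ {pt2 0 0, pt2 a 0, pt2 (a / 2) (a * Real.sqrt 3 / 2)} ⊆
      {x | ∀ k, 0 ≤ triangleCoord a k x} := by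
  have ha' := ha.ne'
  have h3 : (√3 : ℝ) ≠ 0 := by positivity
  refine convexHull_min ?_ ?_
  · have e : ∀ x y : ℝ, (∀ k, 0 ≤ triangleCoord a k (pt2 x y)) ↔
        0 ≤ 1 - x / a - y / (a * √3) ∧ 0 ≤ x / a - y / (a * √3) ∧ 0 ≤ 2 * y / (a * √3) := by
      intro x y
      rw [Fin.forall_fin_succ, Fin.forall_fin_two]
      change 0 ≤ triangleCoord a 0 _ ∧ 0 ≤ triangleCoord a 1 _ ∧ 0 ≤ triangleCoord a 2 _ ↔ _
      rw [triangleCoord_zero, triangleCoord_one, triangleCoord_two]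
      simp [pt2]
    have e1 : a / 2 / a = 1 / 2 := by field_simp
    have e2 : a * √3 / 2 / (a * √3) = 1 / 2 := by field_simp
    have e3 : 2 * (a * √3 / 2) / (a * √3) = 1 := by field_simp
    rintro x (rfl | rfl | rfl)
    · exact (e _ _).2 (by simp)
    · exact (e _ _).2 (by simp [ha'])
    · exact (e _ _).2 (by rw [e1, e2, e3]; norm_num)
  · have : {x | ∀ k, 0 ≤ triangleCoord a k x} =
        ⋂ k, {x | -(![1, 0, 0] : Fin 3 → ℝ) k ≤ triangleLinear a k x} := by
      ext x
      simp only [mem_iInter]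
      exact forall_congr' fun k => neg_le_iff_add_nonneg'.symm
    rw [this]
    exact convex_iInter fun k => convex_halfSpace_ge (triangleLinear a k).isLinear _

theorem mem_closedTriangle {a : ℝ} (ha : 0 < a) {x : EuclideanSpace ℝ (Fin 2)}
    (hx : ∀ k, 0 ≤ triangleCoord a k x) :
    x ∈ convexHull ℝ {pt2 0 0, pt2 a 0, pt2 (a / 2) (a * Real.sqrt 3 / 2)} := by
  have ha' := ha.ne'
  have h3 : (√3 : ℝ) ≠ 0 := by positivity
  have h := (convex_convexHull ℝ {pt2 0 0, pt2 a 0, pt2 (a / 2) (a * Real.sqrt 3 / 2)}).sum_mem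
    (t := Finset.univ) (w := fun k => triangleCoord a k x)
    (z := ![pt2 0 0, pt2 a 0, pt2 (a / 2) (a * Real.sqrt 3 / 2)]) (fun k _ => hx k)
    (by rw [Fin.sum_univ_three]; exact triangleCoord_add a x)
    (fun k _ => subset_convexHull ℝ _ (by fin_cases k <;> simp))
  convert h using 1
  rw [Fin.sum_univ_three, triangleCoord_zero, triangleCoord_one, triangleCoord_two]
  ext i
  fin_cases i
  · simp [pt2]; field_simp; ring
  · simp [pt2]; field_simp

theorem equilateralTriangle_eq {a : ℝ} (ha : 0 < a) :
    equilateralTriangle a = {x | ∀ k, 0 < triangleCoord a k x} := by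
  refine Subset.antisymm (fun x hx k => ?_) (interior_maximal ?_ ?_)
  · have hnn : ∀ᶠ y in nhds x, ∀ k, 0 ≤ triangleCoord a k y :=
      Filter.mem_of_superset (mem_interior_iff_mem_nhds.1 hx) (closedTriangle_subset ha)
    refine (hnn.self_of_nhds k).lt_of_ne fun h0 => triangleLinear_ne_zero ha k ?_
    have hmin : IsLocalMin (triangleCoord a k) x := by
      filter_upwards [hnn] with y hy
      rw [← h0]; exact hy k
    exact hmin.hasFDerivAt_eq_zero ((triangleLinear a k).hasFDerivAt.const_add _)
  · exact fun x hx => mem_closedTriangle ha fun k => (hx k).le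
  · have : {x | ∀ k, 0 < triangleCoord a k x} = ⋂ k, {x | 0 < triangleCoord a k x} := by
      ext x; simp only [mem_iInter]; rfl
    rw [this]
    exact isOpen_iInter_of_finite fun k =>
      isOpen_lt continuous_const (continuous_triangleCoord a k)

theorem nonempty_equilateralTriangle {a : ℝ} (ha : 0 < a) : (equilateralTriangle a).Nonempty := by
  have h3 : 0 < √3 := by positivity
  refine ⟨pt2 (a / 2) (a * √3 / 6), ?_⟩
  rw [equilateralTriangle_eq ha]
  have e1 : a / 2 / a = 1 / 2 := by field_simp
  have e2 : a * √3 / 6 / (a * √3) = 1 / 6 := by field_simp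
  have e3 : 2 * (a * √3 / 6) / (a * √3) = 1 / 3 := by field_simp; norm_num
  intro k
  fin_cases k
  · change 0 < triangleCoord a 0 _
    rw [triangleCoord_zero]; simp [pt2, e1, e2]; norm_num
  · change 0 < triangleCoord a 1 _
    rw [triangleCoord_one]; simp [pt2, e1, e2]; norm_num
  · change 0 < triangleCoord a 2 _
    rw [triangleCoord_two]; simp [pt2, e3]

theorem isBounded_equilateralTriangle (a : ℝ) : Bornology.IsBounded (equilateralTriangle a) :=
  ((isBounded_convexHull.2 (Set.toFinite _).isBounded)).subset interior_subset

/-- The first Dirichlet eigenfunction of the equilateral triangle. -/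
noncomputable def triangleGroundState (a : ℝ) : EuclideanSpace ℝ (Fin 2) → ℝ :=
  sumSinAffine (![1, 0, 0] : Fin 3 → ℝ) (triangleLinear a)

theorem triangleGroundState_eq (a : ℝ) (x : EuclideanSpace ℝ (Fin 2)) :
    triangleGroundState a x = 4 * sin (π * triangleCoord a 0 x) * sin (π * triangleCoord a 1 x) *
      sin (π * triangleCoord a 2 x) := by
  rw [← sin_add_sin_add_sin_eq (triangleCoord_add a x)]
  rw [triangleGroundState, sumSinAffine, Fin.sum_univ_three]
  rfl

theorem triangleGroundState_pos {a : ℝ} (ha : 0 < a) {x : EuclideanSpace ℝ (Fin 2)}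
    (hx : x ∈ equilateralTriangle a) : 0 < triangleGroundState a x := by
  rw [equilateralTriangle_eq ha] at hx
  have h0 := hx 0
  have h1 := hx 1
  have h2 := hx 2
  have hs := triangleCoord_add a x
  have hsin : ∀ t : ℝ, 0 < t → t < 1 → 0 < sin (π * t) := fun t h0 h1 =>
    sin_pos_of_pos_of_lt_pi (by positivity) (by nlinarith [pi_pos])
  rw [triangleGroundState_eq]
  have := hsin _ h0 (by linarith)
  have := hsin _ h1 (by linarith)
  have := hsin _ h2 (by linarith)
  positivity

theorem triangleGroundState_eq_zero {a : ℝ} (ha : 0 < a) {x : EuclideanSpace ℝ (Fin 2)}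
    (hx : x ∈ closure (equilateralTriangle a)) (hx' : x ∉ equilateralTriangle a) :
    triangleGroundState a x = 0 := by
  have hnn : ∀ k, 0 ≤ triangleCoord a k x := fun k =>
    closure_minimal (t := {y | 0 ≤ triangleCoord a k y})
      (fun y hy => (by rw [equilateralTriangle_eq ha] at hy; exact (hy k).le))
      (isClosed_le continuous_const (continuous_triangleCoord a k)) hx
  have hex : ∃ k, triangleCoord a k x = 0 := by
    by_contra! h
    apply hx'
    rw [equilateralTriangle_eq ha]
    exact fun k => (hnn k).lt_of_ne' (h k)
  obtain ⟨k, hk⟩ := hex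
  rw [triangleGroundState_eq]
  fin_cases k <;> simp_all

/-- **The fundamental Dirichlet eigenvalue of an equilateral triangle.** For the open
equilateral triangle `T` with side length `a`, every smooth `u` with compact support in
`T` satisfies `(16/3)(π/a)² ∫_T u² ≤ ∫_T |∇u|²`, and `(16/3)(π/a)²` is the largest
constant with this property. -/
theorem dirichlet_eigenvalue_equilateral_triangle (a : ℝ) (ha : 0 < a) :
    (∀ u : EuclideanSpace ℝ (Fin 2) → ℝ,
        ContDiff ℝ (⊤ : ℕ∞) u → HasCompactSupport u → tsupport u ⊆ equilateralTriangle a →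
        (16 / 3) * (π / a) ^ 2 * ∫ x in equilateralTriangle a, u x ^ 2 ≤
          ∫ x in equilateralTriangle a, ‖fderiv ℝ u x‖ ^ 2) ∧
    (∀ c : ℝ,
      (∀ u : EuclideanSpace ℝ (Fin 2) → ℝ,
        ContDiff ℝ (⊤ : ℕ∞) u → HasCompactSupport u → tsupport u ⊆ equilateralTriangle a →
        c * ∫ x in equilateralTriangle a, u x ^ 2 ≤
          ∫ x in equilateralTriangle a, ‖fderiv ℝ u x‖ ^ 2) →
      c ≤ (16 / 3) * (π / a) ^ 2) := by
  have hl : ∀ x, ∑ i, fderiv ℝ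
      (fun y => fderiv ℝ (triangleGroundState a) y (EuclideanSpace.single i 1)) x
      (EuclideanSpace.single i 1) = -(16 / 3 * (π / a) ^ 2) * triangleGroundState a x := by
    intro x
    rw [triangleGroundState, laplacian_sumSinAffine (sum_triangleLinear_single_sq a)]
    congr 2
    field_simp
    norm_num
  refine ⟨fun u hu hc hT => ?_, fun c h => ?_⟩
  · exact mul_setIntegral_sq_le_setIntegral_norm_fderiv_sq contDiff_sumSinAffine hl
      (fun x hx => triangleGroundState_pos ha hx) hu hc hT
  · exact le_of_forall_mul_setIntegral_sq_le isOpen_interior (isBounded_equilateralTriangle a)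
      (nonempty_equilateralTriangle ha) contDiff_sumSinAffine hl
      (fun x hx => triangleGroundState_pos ha hx)
      (fun x hx hx' => triangleGroundState_eq_zero ha hx hx') h
end
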